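/- arXiv:1910.05058 — 3 statements merged into one kernel-verified Lean document; each statement's English description precedes it below -/
import Mathlib

section
/- Let T be a triangle-tree and let u, v, w be vertices of T. If w does not belong to the vertex set of the unique shortest triangle-path P(u,v,T) of T containing both u and v, then the graph T + uw + vw obtained by adding the two edges uw and vw (parallel edges allowed) is Z3-connected. -/
open scoped Classical

/-- A finite loopless multigraph: finite vertex and edge types, each edge has an
unordered pair of distinct endpoints (parallel edges allowed, loops forbidden). -/
structure Multigraph where
  V : Type
  E : Type
  fintypeV : Fintype V
  fintypeE : Fintype E
  ends : E → Sym2 V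
  loopless : ∀ e, ¬ (ends e).IsDiag

attribute [instance] Multigraph.fintypeV Multigraph.fintypeE

namespace Multigraph

/-- `D` is an orientation of `G`: each edge is assigned an ordered pair (tail, head)
compatible with its endpoints. -/
def IsOrientation (G : Multigraph) (D : G.E → G.V × G.V) : Prop :=
  ∀ e, G.ends e = s((D e).1, (D e).2)

/-- Out-degree of `v` under the orientation `D` (tail = first component). -/
noncomputable def outDeg (G : Multigraph) (D : G.E → G.V × G.V) (v : G.V) : ℕ :=
  {e : G.E | (D e).1 = v}.ncard

/-- In-degree of `v` under the orientation `D` (head = second component). -/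
noncomputable def inDeg (G : Multigraph) (D : G.E → G.V × G.V) (v : G.V) : ℕ :=
  {e : G.E | (D e).2 = v}.ncard

/-- Flow conservation: at every vertex the sum of `f` over outgoing arcs equals the sum
over incoming arcs. -/
def IsConserving (G : Multigraph) (D : G.E → G.V × G.V) (f : G.E → ℤ) : Prop :=
  ∀ v : G.V,
    (∑ e : G.E, if (D e).1 = v then f e else 0) =
      ∑ e : G.E, if (D e).2 = v then f e else 0

/-- `G` has a nowhere-zero 3-flow. -/
def HasNZ3Flow (G : Multigraph) : Prop :=
  ∃ (D : G.E → G.V × G.V) (f : G.E → ℤ),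
    G.IsOrientation D ∧ (∀ e, 1 ≤ |f e| ∧ |f e| ≤ 2) ∧ G.IsConserving D f

/-- `G` is `Z3`-connected: every `Z3`-boundary is realized by some orientation. -/
def Z3Connected (G : Multigraph) : Prop :=
  ∀ β : G.V → ZMod 3, (∑ v : G.V, β v) = 0 →
    ∃ D : G.E → G.V × G.V, G.IsOrientation D ∧
      ∀ v : G.V, ((G.outDeg D v : ZMod 3) - (G.inDeg D v : ZMod 3)) = β v

/-- Degree of a vertex: number of edges incident with it. -/
noncomputable def degree (G : Multigraph) (v : G.V) : ℕ :=
  {e : G.E | v ∈ G.ends e}.ncard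

/-- `(S, F)` is a triangle-tree subgraph of `G`: start from a triangle and repeatedly
add a new vertex joined to the two endpoints of an existing edge. -/
inductive IsTriangleTree (G : Multigraph) : Set G.V → Set G.E → Prop
  | base (x y z : G.V) (e1 e2 e3 : G.E)
      (hxy : x ≠ y) (hxz : x ≠ z) (hyz : y ≠ z)
      (h1 : G.ends e1 = s(x, y)) (h2 : G.ends e2 = s(y, z)) (h3 : G.ends e3 = s(x, z)) :
      IsTriangleTree G {x, y, z} {e1, e2, e3}
  | grow (S : Set G.V) (F : Set G.E) (hT : IsTriangleTree G S F)
      (v a b : G.V) (hv : v ∉ S) (e : G.E) (he : e ∈ F) (hab : G.ends e = s(a, b))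
      (e1 e2 : G.E) (h1 : G.ends e1 = s(v, a)) (h2 : G.ends e2 = s(v, b)) :
      IsTriangleTree G (insert v S) (insert e1 (insert e2 F))

/-- `G` contains a spanning triangle-tree. -/
def HasSpanningTriangleTree (G : Multigraph) : Prop :=
  ∃ F : Set G.E, G.IsTriangleTree Set.univ F

/-- Degree of `v` inside the edge set `F`. -/
noncomputable def degIn (G : Multigraph) (F : Set G.E) (v : G.V) : ℕ :=
  {e : G.E | e ∈ F ∧ v ∈ G.ends e}.ncard

/-- `(S, F)` is a triangle-path subgraph: a triangle-tree which is either a single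
triangle or has exactly two leaves (vertices of degree 2). -/
def IsTrianglePath (G : Multigraph) (S : Set G.V) (F : Set G.E) : Prop :=
  G.IsTriangleTree S F ∧ (S.ncard = 3 ∨ {v ∈ S | G.degIn F v = 2}.ncard = 2)

/-- `(S, F)` is a subgraph of `G`: endpoints of every chosen edge are chosen vertices. -/
def Subgraph (G : Multigraph) (S : Set G.V) (F : Set G.E) : Prop :=
  ∀ e ∈ F, ∀ v, v ∈ G.ends e → v ∈ S

/-- `G` is isomorphic to the complete (simple) graph on `n` vertices. -/
def IsCompleteGraphOn (G : Multigraph) (n : ℕ) : Prop :=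
  ∃ (φ : G.V ≃ Fin n) (ψ : G.E ≃ {p : Sym2 (Fin n) // ¬ p.IsDiag}),
    ∀ e, Sym2.map (⇑φ) (G.ends e) = (ψ e).1

def IsK3 (G : Multigraph) : Prop := G.IsCompleteGraphOn 3

def IsK4 (G : Multigraph) : Prop := G.IsCompleteGraphOn 4

/-- `G` is a bull-growing of `H` (equivalently, `H` is the bull-reduction of `G`):
`u, v` are adjacent vertices of degree 3 in `G` with common neighbour `w`, the remaining
neighbours of `u`, `v` are `a`, `b`, and `H = G - u - v + ab` (with a loop deleted when
`a = b`). -/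
def IsBullGrowing (G H : Multigraph) : Prop :=
  ∃ (u v w a b : G.V) (euv euw evw eua evb : G.E),
    G.ends euv = s(u, v) ∧ G.ends euw = s(u, w) ∧ G.ends evw = s(v, w) ∧
    G.ends eua = s(u, a) ∧ G.ends evb = s(v, b) ∧
    a ≠ v ∧ b ≠ u ∧
    euv ≠ euw ∧ euv ≠ eua ∧ euw ≠ eua ∧
    euv ≠ evw ∧ euv ≠ evb ∧ evw ≠ evb ∧
    {e : G.E | u ∈ G.ends e} = {euv, euw, eua} ∧
    {e : G.E | v ∈ G.ends e} = {euv, evw, evb} ∧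
    ∃ φ : H.V → G.V, Function.Injective φ ∧
      Set.range φ = {x : G.V | x ≠ u ∧ x ≠ v} ∧
      ((a = b → ∃ ψ : H.E → G.E, Function.Injective ψ ∧
          Set.range ψ = {e : G.E | e ∉ ({euv, euw, evw, eua, evb} : Set G.E)} ∧
          ∀ e, G.ends (ψ e) = Sym2.map φ (H.ends e)) ∧
       (a ≠ b → ∃ (e0 : H.E) (ψ : H.E → G.E),
          Sym2.map φ (H.ends e0) = s(a, b) ∧
          Set.InjOn ψ {e : H.E | e ≠ e0} ∧
          ψ '' {e : H.E | e ≠ e0} = {e : G.E | e ∉ ({euv, euw, evw, eua, evb} : Set G.E)} ∧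
          ∀ e, e ≠ e0 → G.ends (ψ e) = Sym2.map φ (H.ends e)))

/-- `(S, F)` is a triangle (a `K3` subgraph) of `G`. -/
def IsTriangleSub (G : Multigraph) (S : Set G.V) (F : Set G.E) : Prop :=
  ∃ (x y z : G.V) (e1 e2 e3 : G.E),
    x ≠ y ∧ x ≠ z ∧ y ≠ z ∧
    G.ends e1 = s(x, y) ∧ G.ends e2 = s(y, z) ∧ G.ends e3 = s(x, z) ∧
    S = {x, y, z} ∧ F = {e1, e2, e3}

/-- The subgraph `(S, F)` of `G` is `Z3`-connected (as a graph in its own right). -/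
def SubZ3Connected (G : Multigraph) (S : Set G.V) (F : Set G.E) : Prop :=
  ∀ β : G.V → ZMod 3, (∀ v, v ∉ S → β v = 0) → (∑ v : G.V, β v) = 0 →
    ∃ D : G.E → G.V × G.V, G.IsOrientation D ∧
      ∀ v ∈ S, (({e : G.E | e ∈ F ∧ (D e).1 = v}.ncard : ZMod 3)
        - ({e : G.E | e ∈ F ∧ (D e).2 = v}.ncard : ZMod 3)) = β v

/-- `G` is the 2-sum of its subgraphs `(SA, FA)` and `(SB, FB)`:
`E(G) = E(A) ∪ E(B)`, `|E(A) ∩ E(B)| = 1` and `|V(A) ∩ V(B)| = 2`. -/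
def IsTwoSum (G : Multigraph) (SA : Set G.V) (FA : Set G.E)
    (SB : Set G.V) (FB : Set G.E) : Prop :=
  G.Subgraph SA FA ∧ G.Subgraph SB FB ∧
  FA ∪ FB = Set.univ ∧ (FA ∩ FB).ncard = 1 ∧ (SA ∩ SB).ncard = 2

/-- All vertices of `G` are joined by walks using only edges from `F`. -/
def ConnOn (G : Multigraph) (F : Set G.E) : Prop :=
  ∀ u v : G.V, Relation.ReflTransGen (fun x y => ∃ e ∈ F, G.ends e = s(x, y)) u v

/-- The spanning subgraph with edge set `F` is 2-edge-connected:
connected and with no cut edge. -/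
def TwoEdgeConnOn (G : Multigraph) (F : Set G.E) : Prop :=
  G.ConnOn F ∧ ∀ e ∈ F, G.ConnOn (F \ {e})

/-- The orientation `D` is strongly connected. -/
def StronglyConnected (G : Multigraph) (D : G.E → G.V × G.V) : Prop :=
  ∀ u v : G.V, Relation.ReflTransGen (fun x y => ∃ e : G.E, D e = (x, y)) u v

/-- `G` belongs to the class `S3`: every `Z3`-boundary is realized by a strongly
connected orientation. -/
def InS3 (G : Multigraph) : Prop :=
  ∀ β : G.V → ZMod 3, (∑ v : G.V, β v) = 0 →
    ∃ D : G.E → G.V × G.V, G.IsOrientation D ∧ G.StronglyConnected D ∧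
      ∀ v : G.V, ((G.outDeg D v : ZMod 3) - (G.inDeg D v : ZMod 3)) = β v

/-- `G` has a cycle (of length ≥ 2, so possibly a pair of parallel edges) all of whose
edges lie in `A`. -/
def HasCycleIn (G : Multigraph) (A : Set G.E) : Prop :=
  ∃ (vs : List G.V) (es : List G.E),
    2 ≤ vs.length ∧ vs.Nodup ∧ es.Nodup ∧ es.length = vs.length ∧
    (∀ e ∈ es, e ∈ A) ∧
    ∀ (i : ℕ) (h1 : i < es.length) (h2 : i < vs.length)
      (h3 : (i + 1) % vs.length < vs.length),
      G.ends (es.get ⟨i, h1⟩) = s(vs.get ⟨i, h2⟩, vs.get ⟨(i + 1) % vs.length, h3⟩)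

/-- `(vs, es)` is a path from `u` to `v` in `G`. -/
def IsPath (G : Multigraph) (u v : G.V) (vs : List G.V) (es : List G.E) : Prop :=
  vs.Nodup ∧ es.Nodup ∧ vs.head? = some u ∧ vs.getLast? = some v ∧
  vs.length = es.length + 1 ∧
  ∀ (i : ℕ) (h1 : i < es.length) (h2 : i < vs.length) (h3 : i + 1 < vs.length),
    G.ends (es.get ⟨i, h1⟩) = s(vs.get ⟨i, h2⟩, vs.get ⟨i + 1, h3⟩)

/-- `H` is isomorphic to the subgraph `(S, F)` of `G`. -/
def IsIsoToSub (H G : Multigraph) (S : Set G.V) (F : Set G.E) : Prop :=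
  ∃ (φ : H.V → G.V) (ψ : H.E → G.E),
    Function.Injective φ ∧ Set.range φ = S ∧
    Function.Injective ψ ∧ Set.range ψ = F ∧
    ∀ e, G.ends (ψ e) = Sym2.map φ (H.ends e)

/-- `G'` is (isomorphic to) the graph obtained from `G` by adding two new edges with
endpoint pairs `p` and `q`. -/
def IsAddTwoEdges (G : Multigraph) (p q : Sym2 G.V) (G' : Multigraph) : Prop :=
  ∃ (φ : G.V ≃ G'.V) (e1 e2 : G'.E), e1 ≠ e2 ∧
    G'.ends e1 = Sym2.map (⇑φ) p ∧ G'.ends e2 = Sym2.map (⇑φ) q ∧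
    ∃ ψ : G.E → G'.E, Function.Injective ψ ∧
      Set.range ψ = {e : G'.E | e ≠ e1 ∧ e ≠ e2} ∧
      ∀ e, G'.ends (ψ e) = Sym2.map (⇑φ) (G.ends e)

/-- `G'` is (isomorphic to) the graph obtained from `G` by deleting the edges in `X`
and adding one new edge with endpoint pair `p`. -/
def IsDeleteAddEdge (G : Multigraph) (X : Set G.E) (p : Sym2 G.V) (G' : Multigraph) : Prop :=
  ∃ (φ : G.V ≃ G'.V) (e0 : G'.E),
    G'.ends e0 = Sym2.map (⇑φ) p ∧
    ∃ ψ : {e : G.E // e ∉ X} → G'.E, Function.Injective ψ ∧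
      Set.range ψ = {e : G'.E | e ≠ e0} ∧
      ∀ e : {e : G.E // e ∉ X}, G'.ends (ψ e) = Sym2.map (⇑φ) (G.ends e.1)

/-- `G` is a crystal: a spanning triangle-path plus one extra edge joining its two
leaves. -/
def IsCrystal (G : Multigraph) : Prop :=
  ∃ (F : Set G.E) (u v : G.V) (e0 : G.E),
    G.IsTrianglePath Set.univ F ∧ u ≠ v ∧
    G.degIn F u = 2 ∧ G.degIn F v = 2 ∧
    e0 ∉ F ∧ G.ends e0 = s(u, v) ∧ insert e0 F = Set.univ

/-- The subgraph with edge set `F` is triangularly connected: any two of its edges lie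
on a common triangle-path inside it. -/
def TriangularlyConnectedOn (G : Multigraph) (F : Set G.E) : Prop :=
  ∀ e1 ∈ F, ∀ e2 ∈ F, ∃ (S : Set G.V) (F' : Set G.E),
    F' ⊆ F ∧ G.IsTrianglePath S F' ∧ e1 ∈ F' ∧ e2 ∈ F'

/-- `G` is triangularly connected. -/
def TriangularlyConnected (G : Multigraph) : Prop :=
  G.TriangularlyConnectedOn Set.univ

/-- `G` contains a spanning triangularly-connected subgraph. -/
def HasSpanningTriangularlyConnected (G : Multigraph) : Prop :=
  ∃ F : Set G.E, G.TriangularlyConnectedOn F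

/-- `G` admits a circular `t/s`-flow. -/
def HasCircularFlow (G : Multigraph) (t s : ℤ) : Prop :=
  ∃ (D : G.E → G.V × G.V) (f : G.E → ℤ),
    G.IsOrientation D ∧ (∀ e, s ≤ |f e| ∧ |f e| ≤ t - s) ∧ G.IsConserving D f

end Multigraph

/-- `G` can be obtained from `K4` by a (possibly empty) series of bull-growing
operations. -/
inductive FromK4ByBull : Multigraph → Prop
  | base (G : Multigraph) : G.IsK4 → FromK4ByBull G
  | grow (G H : Multigraph) : FromK4ByBull H → G.IsBullGrowing H → FromK4ByBull G

namespace Multigraph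

/-- Induction principle for triangle-trees starting from a single edge. -/
lemma tree_ind (G : Multigraph) (P : Set G.V → Set G.E → Prop)
    (hbase : ∀ x y e, x ≠ y → G.ends e = s(x, y) → P {x, y} {e})
    (hstep : ∀ S F, G.Subgraph S F → P S F → ∀ v a b, v ∉ S → ∀ e ∈ F, G.ends e = s(a, b) →
      a ∈ S → b ∈ S → a ≠ b → ∀ e1 e2, G.ends e1 = s(v, a) → G.ends e2 = s(v, b) →
      e1 ≠ e2 → e1 ∉ F → e2 ∉ F →
      P (insert v S) (insert e1 (insert e2 F)))
    {S : Set G.V} {F : Set G.E} (h : G.IsTriangleTree S F) : G.Subgraph S F ∧ P S F := by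
  have key : ∀ S F, G.Subgraph S F → P S F → ∀ v a b, v ∉ S → ∀ e ∈ F, G.ends e = s(a, b) →
      ∀ e1 e2, G.ends e1 = s(v, a) → G.ends e2 = s(v, b) →
      G.Subgraph (insert v S) (insert e1 (insert e2 F)) ∧
      P (insert v S) (insert e1 (insert e2 F)) := by
    intro S F hS hP v a b hv e he hab e1 e2 h1 h2
    have ha : a ∈ S := hS e he a (by simp [hab])
    have hb : b ∈ S := hS e he b (by simp [hab])
    have hne : a ≠ b := by
      rintro rfl
      exact G.loopless e (by simp [hab])
    refine ⟨?_, hstep S F hS hP v a b hv e he hab ha hb hne e1 e2 h1 h2 ?_ ?_ ?_⟩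
    · intro f hf x hx
      rcases hf with rfl | rfl | hf
      · rw [h1] at hx
        rcases Sym2.mem_iff.1 hx with rfl | rfl
        · exact Set.mem_insert _ _
        · exact Set.mem_insert_of_mem _ ha
      · rw [h2] at hx
        rcases Sym2.mem_iff.1 hx with rfl | rfl
        · exact Set.mem_insert _ _
        · exact Set.mem_insert_of_mem _ hb
      · exact Set.mem_insert_of_mem _ (hS f hf x hx)
    · rintro rfl
      rw [h1] at h2
      exact hne (Sym2.congr_right.1 h2)
    · intro hf
      exact hv (hS e1 hf v (by simp [h1]))
    · intro hf
      exact hv (hS e2 hf v (by simp [h2]))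
  induction h with
  | base x y z e1 e2 e3 hxy hxz hyz h1 h2 h3 =>
    have h0 := key {x, y} {e1} ?_ (hbase x y e1 hxy h1) z x y ?_ e1 rfl h1 e3 e2
      (by rw [h3, Sym2.eq_swap]) (by rw [h2, Sym2.eq_swap])
    · have hs : ({x, y, z} : Set G.V) = insert z {x, y} := by
        ext; simp; tauto
      have hf : ({e1, e2, e3} : Set G.E) = insert e3 (insert e2 {e1}) := by
        ext; simp; tauto
      rw [hs, hf]
      exact h0
    · intro e he x' hx'
      rw [Set.mem_singleton_iff.1 he, h1] at hx'
      simpa using hx'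
    · simp [hxz.symm, hyz.symm]
  | grow S F hT v a b hv e he hab e1 e2 h1 h2 ih =>
    exact key S F ih.1 ih.2 v a b hv e he hab e1 e2 h1 h2

/-- The triangles (3-cliques) of the edge set `F`. -/
noncomputable def cliq (G : Multigraph) (F : Set G.E) : Finset (Finset G.V) :=
  Finset.univ.filter fun t => t.card = 3 ∧
    ∀ x ∈ t, ∀ y ∈ t, x ≠ y → ∃ e ∈ F, G.ends e = s(x, y)

/-- Indicator vector. -/
noncomputable def ind (G : Multigraph) (t : Finset G.V) : G.V → ZMod 3 :=
  fun x => if x ∈ t then 1 else 0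

noncomputable def pt (G : Multigraph) (v : G.V) : G.V → ZMod 3 :=
  fun x => if x = v then 1 else 0

lemma mem_cliq (G : Multigraph) {F : Set G.E} {t : Finset G.V} : t ∈ G.cliq F ↔ t.card = 3 ∧
    ∀ x ∈ t, ∀ y ∈ t, x ≠ y → ∃ e ∈ F, G.ends e = s(x, y) := by
  simp [cliq]

lemma cliq_mono (G : Multigraph) {F F' : Set G.E} (h : F ⊆ F') : G.cliq F ⊆ G.cliq F' := by
  intro t ht
  rw [mem_cliq] at ht ⊢
  refine ⟨ht.1, fun x hx y hy hxy => ?_⟩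
  obtain ⟨e, he, h'⟩ := ht.2 x hx y hy hxy
  exact ⟨e, h he, h'⟩

lemma cliq_sub (G : Multigraph) {S : Set G.V} {F : Set G.E} (h : G.Subgraph S F)
    {t : Finset G.V} (ht : t ∈ G.cliq F) {x : G.V} (hx : x ∈ t) : x ∈ S := by
  rw [mem_cliq] at ht
  obtain ⟨y, hy, hxy⟩ := Finset.exists_mem_ne (by omega : 1 < t.card) x
  obtain ⟨e, he, h'⟩ := ht.2 x hx y hy hxy.symm
  exact h e he x (by simp [h'])

lemma cliq_single (G : Multigraph) {x y : G.V} {e : G.E} (he : G.ends e = s(x, y)) :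
    G.cliq {e} = ∅ := by
  ext t
  simp only [Finset.notMem_empty, iff_false]
  intro ht
  have hs : G.Subgraph {x, y} {e} := by
    intro f hf x' hx'
    rw [Set.mem_singleton_iff.1 hf, he] at hx'
    simpa using hx'
  have h2 : t ⊆ {x, y} := by
    intro z hz
    simpa using G.cliq_sub hs ht hz
  have := Finset.card_le_card h2
  have := Finset.card_le_two (a := x) (b := y)
  have := (G.mem_cliq.1 ht).1
  omega

lemma cliq_grow (G : Multigraph) {S : Set G.V} {F : Set G.E} (h : G.Subgraph S F)
    {v a b : G.V} (hv : v ∉ S) {e : G.E} (he : e ∈ F) (hab : G.ends e = s(a, b))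
    (ha : a ∈ S) (hb : b ∈ S) (hne : a ≠ b)
    {e1 e2 : G.E} (h1 : G.ends e1 = s(v, a)) (h2 : G.ends e2 = s(v, b)) :
    G.cliq (insert e1 (insert e2 F)) = insert {v, a, b} (G.cliq F) := by
  have hva : v ≠ a := by rintro rfl; exact hv ha
  have hvb : v ≠ b := by rintro rfl; exact hv hb
  have hnb : ∀ x, x ≠ v → ∀ f ∈ insert e1 (insert e2 F), G.ends f = s(v, x) → x = a ∨ x = b := by
    intro x hx f hf hfx
    rcases hf with rfl | rfl | hf
    · rw [h1] at hfx; left; exact (Sym2.congr_right.1 hfx).symm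
    · rw [h2] at hfx; right; exact (Sym2.congr_right.1 hfx).symm
    · exact absurd (h f hf v (by simp [hfx])) hv
  have hcard : ({v, a, b} : Finset G.V).card = 3 := by
    rw [Finset.card_eq_three]; exact ⟨v, a, b, hva, hvb, hne, rfl⟩
  apply Finset.Subset.antisymm
  · intro t ht
    have ht' := G.mem_cliq.1 ht
    rw [Finset.mem_insert]
    by_cases hvt : v ∈ t
    · left
      apply Finset.eq_of_subset_of_card_le _ (by omega)
      intro x hx
      by_cases hxv : x = v
      · simp [hxv]
      · obtain ⟨f, hf, hfx⟩ := ht'.2 v hvt x hx (Ne.symm hxv)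
        have := hnb x hxv f hf hfx
        simp [this]
    · right
      rw [mem_cliq]
      refine ⟨ht'.1, fun x hx y hy hxy => ?_⟩
      obtain ⟨f, hf, hfx⟩ := ht'.2 x hx y hy hxy
      refine ⟨f, ?_, hfx⟩
      rcases hf with rfl | rfl | hf
      · exfalso
        rw [h1] at hfx
        have : v ∈ s(x, y) := by rw [← hfx]; simp
        rcases Sym2.mem_iff.1 this with rfl | rfl <;> exact hvt ‹_›
      · exfalso
        rw [h2] at hfx
        have : v ∈ s(x, y) := by rw [← hfx]; simp
        rcases Sym2.mem_iff.1 this with rfl | rfl <;> exact hvt ‹_›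
      · exact hf
  · intro t ht
    rcases Finset.mem_insert.1 ht with rfl | ht
    · rw [mem_cliq]
      refine ⟨hcard, ?_⟩
      intro x hx y hy hxy
      simp only [Finset.mem_insert, Finset.mem_singleton] at hx hy
      have i1 : e1 ∈ insert e1 (insert e2 F) := by simp
      have i2 : e2 ∈ insert e1 (insert e2 F) := by simp
      have i3 : e ∈ insert e1 (insert e2 F) := by simp [he]
      rcases hx with rfl | rfl | rfl <;> rcases hy with rfl | rfl | rfl <;>
        first
        | exact absurd rfl hxy
        | exact ⟨e1, i1, h1⟩
        | exact ⟨e2, i2, h2⟩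
        | exact ⟨e, i3, hab⟩
        | exact ⟨e1, i1, h1.trans Sym2.eq_swap⟩
        | exact ⟨e2, i2, h2.trans Sym2.eq_swap⟩
        | exact ⟨e, i3, hab.trans Sym2.eq_swap⟩
    · exact G.cliq_mono (fun f hf => by simp [hf]) ht

lemma new_notMem (G : Multigraph) {S : Set G.V} {F : Set G.E} (h : G.Subgraph S F)
    {v a b : G.V} (hv : v ∉ S) : ({v, a, b} : Finset G.V) ∉ G.cliq F :=
  fun ht => hv (G.cliq_sub h ht (by simp))

lemma ind_new (G : Multigraph) {v a b : G.V} (hva : v ≠ a) (hvb : v ≠ b) (hab : a ≠ b) :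
    G.ind {v, a, b} = G.pt v + G.pt a + G.pt b := by
  ext x
  simp only [ind, pt, Finset.mem_insert, Finset.mem_singleton, Pi.add_apply]
  by_cases h1 : x = v <;> by_cases h2 : x = a <;> by_cases h3 : x = b <;> simp_all

/-- Linear combination of triangles. -/
noncomputable def comb (G : Multigraph) (F : Set G.E) (σ : Finset G.V → ZMod 3) : G.V → ZMod 3 :=
  ∑ t ∈ G.cliq F, σ t • G.ind t

/-- A proper 3-coloring. -/
def Col (G : Multigraph) (F : Set G.E) (c : G.V → ZMod 3) : Prop :=
  ∀ e ∈ F, ∀ x y, G.ends e = s(x, y) → c x ≠ c y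

lemma exists_col (G : Multigraph) {S : Set G.V} {F : Set G.E} (h : G.IsTriangleTree S F) :
    ∃ c, G.Col F c := by
  refine (G.tree_ind (fun _ F => ∃ c, G.Col F c) ?_ ?_ h).2
  · intro x y e hxy he
    refine ⟨G.pt x, ?_⟩
    intro f hf x' y' hf'
    rw [Set.mem_singleton_iff.1 hf, he] at hf'
    rcases Sym2.eq_iff.1 hf' with ⟨rfl, rfl⟩ | ⟨rfl, rfl⟩ <;> simp [pt, hxy.symm]
  · rintro S F hS ⟨c, hc⟩ v a b hv e he hab ha hb hne e1 e2 h1 h2 - - -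
    have hva : a ≠ v := by rintro rfl; exact hv ha
    have hvb : b ≠ v := by rintro rfl; exact hv hb
    have hcab := hc e he a b hab
    have key : ∀ p q : ZMod 3, p ≠ q → - p - q ≠ p ∧ - p - q ≠ q := by decide
    obtain ⟨k1, k2⟩ := key _ _ hcab
    refine ⟨Function.update c v (- c a - c b), ?_⟩
    intro f hf x y hfx
    rcases hf with rfl | rfl | hf
    · rw [h1] at hfx
      rcases Sym2.eq_iff.1 hfx with ⟨rfl, rfl⟩ | ⟨rfl, rfl⟩ <;>
        simp only [Function.update_self, Function.update_of_ne hva]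
      · exact k1
      · exact k1.symm
    · rw [h2] at hfx
      rcases Sym2.eq_iff.1 hfx with ⟨rfl, rfl⟩ | ⟨rfl, rfl⟩ <;>
        simp only [Function.update_self, Function.update_of_ne hvb]
      · exact k2
      · exact k2.symm
    · have hx : x ≠ v := by rintro rfl; exact hv (hS f hf x (by simp [hfx]))
      have hy : y ≠ v := by rintro rfl; exact hv (hS f hf y (by simp [hfx]))
      rw [Function.update_of_ne hx, Function.update_of_ne hy]
      exact hc f hf x y hfx

lemma col_ind (G : Multigraph) {F : Set G.E} {c : G.V → ZMod 3} (hc : G.Col F c)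
    {t : Finset G.V} (ht : t ∈ G.cliq F) : ∑ x, c x * G.ind t x = 0 := by
  obtain ⟨h3, h⟩ := G.mem_cliq.1 ht
  obtain ⟨x, y, z, hxy, hxz, hyz, rfl⟩ := Finset.card_eq_three.1 h3
  have d : ∀ x' ∈ ({x, y, z} : Finset G.V), ∀ y' ∈ ({x, y, z} : Finset G.V), x' ≠ y' →
      c x' ≠ c y' := by
    intro x' hx' y' hy' hne
    obtain ⟨e, he, h'⟩ := h x' hx' y' hy' hne
    exact hc e he _ _ h'
  have k : ∀ p q r : ZMod 3, p ≠ q → p ≠ r → q ≠ r → p + (q + r) = 0 := by decide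
  simp only [ind, mul_ite, mul_one, mul_zero, Finset.sum_ite_mem, Finset.univ_inter]
  rw [Finset.sum_insert (by simp [hxy, hxz]), Finset.sum_insert (by simp [hyz]),
    Finset.sum_singleton]
  exact k _ _ _ (d x (by simp) y (by simp) hxy) (d x (by simp) z (by simp) hxz)
    (d y (by simp) z (by simp) hyz)

lemma col_comb (G : Multigraph) {F : Set G.E} {c : G.V → ZMod 3} (hc : G.Col F c)
    (σ : Finset G.V → ZMod 3) : ∑ x, c x * G.comb F σ x = 0 := by
  simp only [comb, Finset.sum_apply, Pi.smul_apply, smul_eq_mul, Finset.mul_sum]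
  rw [Finset.sum_comm]
  apply Finset.sum_eq_zero
  intro t ht
  have := G.col_ind hc ht
  calc _ = σ t * ∑ x, c x * G.ind t x := by
        rw [Finset.mul_sum]; exact Finset.sum_congr rfl fun x _ => by ring
    _ = 0 := by rw [this, mul_zero]

lemma comb_sub (G : Multigraph) (F : Set G.E) (σ τ : Finset G.V → ZMod 3) :
    G.comb F (σ - τ) = G.comb F σ - G.comb F τ := by
  simp [comb, sub_smul]

lemma comb_supp (G : Multigraph) {S : Set G.V} {F : Set G.E} (h : G.Subgraph S F)
    (σ : Finset G.V → ZMod 3) {v : G.V} (hv : v ∉ S) : G.comb F σ v = 0 := by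
  simp only [comb, Finset.sum_apply, Pi.smul_apply, smul_eq_mul]
  apply Finset.sum_eq_zero
  intro t ht
  have : v ∉ t := fun hvt => hv (G.cliq_sub h ht hvt)
  simp [ind, this]

lemma sum_pt (G : Multigraph) (v : G.V) : ∑ x, G.pt v x = 0 + 1 := by
  simp [pt]

lemma sum_mul_pt (G : Multigraph) (c : G.V → ZMod 3) (v : G.V) : ∑ x, c x * G.pt v x = c v := by
  simp [pt]

lemma comb_indep (G : Multigraph) {S : Set G.V} {F : Set G.E} (h : G.IsTriangleTree S F) :
    ∀ σ, G.comb F σ = 0 → ∀ t ∈ G.cliq F, σ t = 0 := by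
  refine (G.tree_ind (fun _ F => ∀ σ, G.comb F σ = 0 → ∀ t ∈ G.cliq F, σ t = 0) ?_ ?_ h).2
  · intro x y e hxy he
    rw [G.cliq_single he]
    simp
  · intro S F hS ih v a b hv e he hab ha hb hne e1 e2 h1 h2 _ _ _ σ hσ
    have hn := G.new_notMem hS (a := a) (b := b) hv
    have hex : G.comb (insert e1 (insert e2 F)) σ = σ {v, a, b} • G.ind {v, a, b} + G.comb F σ := by
      rw [comb, G.cliq_grow hS hv he hab ha hb hne h1 h2, Finset.sum_insert hn, comb]
    rw [hex] at hσ
    have h0 : σ {v, a, b} = 0 := by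
      have := congrFun hσ v
      simpa [G.comb_supp hS σ hv, ind] using this
    rw [h0, zero_smul, zero_add] at hσ
    rw [G.cliq_grow hS hv he hab ha hb hne h1 h2]
    intro t ht
    rcases Finset.mem_insert.1 ht with rfl | ht
    · exact h0
    · exact ih σ hσ t ht

/-- Supported on `S`, of total zero. -/
def Bal (G : Multigraph) (S : Set G.V) (β : G.V → ZMod 3) : Prop :=
  (∀ v, v ∉ S → β v = 0) ∧ ∑ v, β v = 0

lemma bal_pair (G : Multigraph) {x y : G.V} (hxy : x ≠ y) {β : G.V → ZMod 3}
    (h : G.Bal {x, y} β) : β = β x • (G.pt x - G.pt y) := by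
  have h2 : ∑ v ∈ ({x, y} : Finset G.V), β v = 0 := by
    rw [← h.2]
    apply Finset.sum_subset (Finset.subset_univ _)
    intro v _ hv
    exact h.1 v (by simpa using hv)
  rw [Finset.sum_pair hxy] at h2
  ext v
  by_cases hvx : v = x
  · subst hvx; simp [pt, hxy]
  by_cases hvy : v = y
  · subst hvy; simp [pt, hxy.symm]; linear_combination h2
  · simp [pt, hvx, hvy, h.1 v (by simp [hvx, hvy])]

lemma bal_sub (G : Multigraph) {S : Set G.V} {β : G.V → ZMod 3} {v a b : G.V} (hv : v ∉ S)
    (ha : a ∈ S) (hb : b ∈ S) (h : G.Bal (insert v S) β) :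
    G.Bal S (β - β v • (G.pt v + G.pt a + G.pt b)) := by
  have hva : v ≠ a := by rintro rfl; exact hv ha
  have hvb : v ≠ b := by rintro rfl; exact hv hb
  constructor
  · intro x hx
    have hxa : x ≠ a := by rintro rfl; exact hx ha
    have hxb : x ≠ b := by rintro rfl; exact hx hb
    by_cases hxv : x = v
    · subst hxv; simp [pt, hxa, hxb]
    · simp [pt, hxa, hxb, hxv, h.1 x (by simp [hxv, hx])]
  · have h3 : (1 : ZMod 3) + 1 + 1 = 0 := by decide
    simp only [Pi.sub_apply, Pi.smul_apply, Pi.add_apply, smul_eq_mul, Finset.sum_sub_distrib,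
      ← Finset.mul_sum, Finset.sum_add_distrib, sum_pt, h.2]
    linear_combination (- β v) * h3

/-- Extend coefficients to the new triangle. -/
lemma comb_grow (G : Multigraph) {S : Set G.V} {F : Set G.E} (hS : G.Subgraph S F)
    {v a b : G.V} (hv : v ∉ S) {e : G.E} (he : e ∈ F) (hab : G.ends e = s(a, b))
    (ha : a ∈ S) (hb : b ∈ S) (hne : a ≠ b)
    {e1 e2 : G.E} (h1 : G.ends e1 = s(v, a)) (h2 : G.ends e2 = s(v, b))
    (σ : Finset G.V → ZMod 3) (p : ZMod 3) :
    G.comb (insert e1 (insert e2 F)) (Function.update σ {v, a, b} p) =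
      p • (G.pt v + G.pt a + G.pt b) + G.comb F σ := by
  have hva : v ≠ a := by rintro rfl; exact hv ha
  have hvb : v ≠ b := by rintro rfl; exact hv hb
  have hn := G.new_notMem hS (a := a) (b := b) hv
  rw [comb, G.cliq_grow hS hv he hab ha hb hne h1 h2, Finset.sum_insert hn, comb,
    Function.update_self, G.ind_new hva hvb hne]
  congr 1
  apply Finset.sum_congr rfl
  intro t ht
  rw [Function.update_of_ne]
  rintro rfl
  exact hn ht

lemma comb_span (G : Multigraph) {S : Set G.V} {F : Set G.E} (h : G.IsTriangleTree S F)
    (c : G.V → ZMod 3) : G.Col F c → ∀ β, G.Bal S β → ∑ x, c x * β x = 0 → ∃ σ, β = G.comb F σ := by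
  refine (G.tree_ind (fun S F => G.Col F c → ∀ β, G.Bal S β → ∑ x, c x * β x = 0 →
    ∃ σ, β = G.comb F σ) ?_ ?_ h).2
  · intro x y e hxy he hc β hβ hcβ
    have hb := G.bal_pair hxy hβ
    refine ⟨0, ?_⟩
    have hcol := hc e rfl x y he
    rw [hb] at hcβ
    have : β x * (c x - c y) = 0 := by
      rw [← hcβ, ← G.sum_mul_pt c x, ← G.sum_mul_pt c y, ← Finset.sum_sub_distrib, Finset.mul_sum]
      refine Finset.sum_congr rfl fun z _ => ?_
      simp; ring
    have key : ∀ p q r : ZMod 3, p * (q - r) = 0 → q ≠ r → p = 0 := by decide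
    rw [hb, key _ _ _ this hcol]
    simp [comb]
  · intro S F hS ih v a b hv e he hab ha hb hne e1 e2 h1 h2 _ _ _ hc β hβ hcβ
    have hva : v ≠ a := by rintro rfl; exact hv ha
    have hvb : v ≠ b := by rintro rfl; exact hv hb
    have ht : {v, a, b} ∈ G.cliq (insert e1 (insert e2 F)) := by
      rw [G.cliq_grow hS hv he hab ha hb hne h1 h2]; simp
    have hz := G.col_ind hc ht
    rw [G.ind_new hva hvb hne] at hz
    obtain ⟨σ, hσ⟩ := ih (fun f hf => hc f (by simp [hf])) _ (G.bal_sub hv ha hb hβ) (by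
      have : ∑ x, c x * (β - β v • (G.pt v + G.pt a + G.pt b)) x
        = ∑ x, c x * β x - β v * ∑ x, c x * (G.pt v + G.pt a + G.pt b) x := by
          rw [Finset.mul_sum, ← Finset.sum_sub_distrib]
          refine Finset.sum_congr rfl fun z _ => ?_
          simp only [Pi.sub_apply, Pi.smul_apply, smul_eq_mul]; ring
      rw [this, hcβ, hz]; simp)
    refine ⟨Function.update σ {v, a, b} (β v), ?_⟩
    rw [G.comb_grow hS hv he hab ha hb hne h1 h2, ← hσ]
    abel

/-- Boundary `β` is realized by an orientation of the edge set `F`. -/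
def Bd (G : Multigraph) (F : Set G.E) (β : G.V → ZMod 3) : Prop :=
  ∃ g : G.E → G.V → ZMod 3, (∀ e, ∃ x y, G.ends e = s(x, y) ∧ g e = G.pt x - G.pt y) ∧
    ∑ e, (if e ∈ F then g e else 0) = β

lemma exists_or (G : Multigraph) (e : G.E) :
    ∃ g : G.V → ZMod 3, ∃ x y, G.ends e = s(x, y) ∧ g = G.pt x - G.pt y := by
  induction h : G.ends e with | _ x y => exact ⟨_, x, y, rfl, rfl⟩

lemma bd_insert (G : Multigraph) {F : Set G.E} {e : G.E} (he : e ∉ F) {x y : G.V}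
    (hxy : G.ends e = s(x, y)) {β : G.V → ZMod 3} (h : G.Bd F β) :
    G.Bd (insert e F) (G.pt x - G.pt y + β) := by
  obtain ⟨g, hg, hs⟩ := h
  refine ⟨Function.update g e (G.pt x - G.pt y), ?_, ?_⟩
  · intro f
    by_cases hf : f = e
    · subst hf; exact ⟨x, y, hxy, by simp⟩
    · rw [Function.update_of_ne hf]; exact hg f
  · rw [← hs, ← Finset.add_sum_erase _ _ (Finset.mem_univ e),
      ← Finset.add_sum_erase Finset.univ (fun e => if e ∈ F then g e else 0) (Finset.mem_univ e)]
    simp only [Set.mem_insert_iff, true_or, if_true, Function.update_self, he, if_false, zero_add]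
    congr 1
    apply Finset.sum_congr rfl
    intro f hf
    have hf : f ≠ e := Finset.ne_of_mem_erase hf
    simp [hf, Function.update_of_ne]

lemma bd_or (G : Multigraph) {S : Set G.V} {F : Set G.E} (h : G.IsTriangleTree S F) :
    (∃ c, G.Col F c) ∧ ∀ β, G.Bal S β → G.Bd F β ∨ ∃ σ, (∀ t, σ t ≠ 0) ∧ β = G.comb F σ := by
  refine ⟨G.exists_col h, ?_⟩
  obtain ⟨c, hc⟩ := G.exists_col h
  revert hc
  refine (G.tree_ind (fun S F => G.Col F c → ∀ β, G.Bal S β → G.Bd F β ∨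
    ∃ σ, (∀ t, σ t ≠ 0) ∧ β = G.comb F σ) ?_ ?_ h).2
  · intro x y e hxy he _ β hβ
    have hb := G.bal_pair hxy hβ
    have hemp : G.Bd ∅ 0 := by
      choose g hg using G.exists_or
      exact ⟨g, hg, by simp⟩
    have tri : ∀ p : ZMod 3, p = 0 ∨ p = 1 ∨ p = -1 := by decide
    rcases tri (β x) with h0 | h0 | h0
    · right
      refine ⟨1, by simp, ?_⟩
      rw [hb, h0, comb, G.cliq_single he]; simp
    · left
      have := G.bd_insert (Set.notMem_empty e) he hemp
      rw [hb, h0]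
      simpa using this
    · left
      have := G.bd_insert (Set.notMem_empty e) (he.trans Sym2.eq_swap) hemp
      rw [hb, h0]
      simpa using this
  · intro S F hS ih v a b hv e he hab ha hb hne e1 e2 h1 h2 h12 hf1 hf2 hc β hβ
    have hc' : G.Col F c := fun f hf => hc f (by simp [hf])
    have ih := ih hc'
    have h1' := h1.trans Sym2.eq_swap
    have h2' := h2.trans Sym2.eq_swap
    have hf1' : e1 ∉ insert e2 F := by simp [h12, hf1]
    have tri : ∀ p : ZMod 3, p = 0 ∨ p = 1 ∨ p = -1 := by decide
    have three : ∀ p : ZMod 3, p + p + p = 0 := by decide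
    have hbal := G.bal_sub hv ha hb hβ
    have main : β v ≠ 0 → (G.Bd F (β - β v • (G.pt v + G.pt a + G.pt b)) →
        G.Bd (insert e1 (insert e2 F)) β) → G.Bd (insert e1 (insert e2 F)) β ∨
        ∃ σ, (∀ t, σ t ≠ 0) ∧ β = G.comb (insert e1 (insert e2 F)) σ := by
      intro hne0 himp
      rcases ih _ hbal with hB | ⟨σ, hσ0, hσ⟩
      · exact Or.inl (himp hB)
      · right
        refine ⟨Function.update σ {v, a, b} (β v), ?_, ?_⟩
        · intro t
          by_cases ht : t = {v, a, b}
          · rw [ht]; simpa using hne0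
          · rw [Function.update_of_ne ht]; exact hσ0 t
        · rw [G.comb_grow hS hv he hab ha hb hne h1 h2, ← hσ]
          abel
    rcases tri (β v) with h0 | h0 | h0
    · left
      rw [h0, zero_smul, sub_zero] at hbal
      have hd : G.Bal S (G.pt a - G.pt b) := by
        constructor
        · intro x hx
          have hxa : x ≠ a := by rintro rfl; exact hx ha
          have hxb : x ≠ b := by rintro rfl; exact hx hb
          simp [pt, hxa, hxb]
        · simp [sum_pt]
      have hp : G.Bal S (β + (G.pt a - G.pt b)) :=
        ⟨fun x hx => by simp only [Pi.add_apply, hbal.1 x hx, hd.1 x hx, add_zero],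
          by simp only [Pi.add_apply, Finset.sum_add_distrib, hbal.2, hd.2, add_zero]⟩
      have hm : G.Bal S (β - (G.pt a - G.pt b)) :=
        ⟨fun x hx => by rw [Pi.sub_apply, hbal.1 x hx, hd.1 x hx, sub_zero],
          by simp only [Pi.sub_apply β, Finset.sum_sub_distrib β, hbal.2, hd.2, sub_zero]⟩
      rcases ih _ hp with hB | ⟨σ, -, hσ⟩
      · have := G.bd_insert hf1' h1 (G.bd_insert hf2 h2' hB)
        convert this using 1
        abel
      rcases ih _ hm with hB | ⟨τ, -, hτ⟩
      · have := G.bd_insert hf1' h1' (G.bd_insert hf2 h2 hB)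
        convert this using 1
        abel
      exfalso
      have hdd : G.pt a - G.pt b = G.comb F (τ - σ) := by
        rw [comb_sub, ← hσ, ← hτ]
        ext x
        simp only [Pi.sub_apply, Pi.add_apply]
        linear_combination three (G.pt a x - G.pt b x)
      have := G.col_comb hc' (τ - σ)
      rw [← hdd] at this
      simp only [Pi.sub_apply, mul_sub, Finset.sum_sub_distrib, sum_mul_pt] at this
      exact hc' e he a b hab (sub_eq_zero.1 this)
    · apply main (by rw [h0]; decide)
      intro hB
      have := G.bd_insert hf1' h1' (G.bd_insert hf2 h2' hB)
      convert this using 1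
      ext x
      simp only [Pi.sub_apply, Pi.add_apply, Pi.smul_apply, smul_eq_mul, h0]
      linear_combination three (G.pt v x)
    · apply main (by rw [h0]; decide)
      intro hB
      have := G.bd_insert hf1' h1 (G.bd_insert hf2 h2 hB)
      convert this using 1
      ext x
      simp only [Pi.sub_apply, Pi.add_apply, Pi.smul_apply, smul_eq_mul, h0]
      linear_combination - three (G.pt v x)

/-- Combinatorial core. -/
lemma core (T : Multigraph) (hT : T.IsTriangleTree Set.univ Set.univ)
    (u v w : T.V) (S : Set T.V) (F : Set T.E) (hP : T.IsTriangleTree S F)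
    (hu : u ∈ S) (hv : v ∈ S) (hw : w ∉ S) (β : T.V → ZMod 3) (hβ : ∑ x, β x = 0) :
    ∃ p q : ZMod 3, (p = 1 ∨ p = -1) ∧ (q = 1 ∨ q = -1) ∧
      T.Bd Set.univ (β + p • (T.pt u - T.pt w) + q • (T.pt v - T.pt w)) := by
  by_contra! hcon
  obtain ⟨⟨c, hc⟩, hor⟩ := T.bd_or hT
  have ex : ∀ p q : ZMod 3, (p = 1 ∨ p = -1) → (q = 1 ∨ q = -1) → ∃ σ, (∀ t, σ t ≠ 0) ∧
      β + p • (T.pt u - T.pt w) + q • (T.pt v - T.pt w) = T.comb Set.univ σ := by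
    intro p q hp hq
    refine (hor _ ⟨fun x hx => absurd (Set.mem_univ x) hx, ?_⟩).resolve_left (hcon p q hp hq)
    simp [Finset.sum_add_distrib, hβ, ← Finset.mul_sum, sum_pt]
  obtain ⟨σ1, n1, h1⟩ := ex 1 1 (by simp) (by simp)
  obtain ⟨σ2, n2, h2⟩ := ex 1 (-1) (by simp) (by simp)
  obtain ⟨σ3, n3, h3⟩ := ex (-1) 1 (by simp) (by simp)
  obtain ⟨σ4, n4, h4⟩ := ex (-1) (-1) (by simp) (by simp)
  have three : ∀ p : ZMod 3, p + p + p = 0 := by decide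
  have hd1 : T.pt u - T.pt w = T.comb Set.univ (σ3 - σ1) := by
    rw [comb_sub, ← h1, ← h3]
    ext x
    simp only [Pi.sub_apply, Pi.add_apply, Pi.smul_apply, smul_eq_mul]
    linear_combination three (T.pt u x - T.pt w x)
  have hd2 : T.pt v - T.pt w = T.comb Set.univ (σ2 - σ1) := by
    rw [comb_sub, ← h1, ← h2]
    ext x
    simp only [Pi.sub_apply, Pi.add_apply, Pi.smul_apply, smul_eq_mul]
    linear_combination three (T.pt v x - T.pt w x)
  have hind := T.comb_indep hT
  have h1234 : ∀ t ∈ T.cliq Set.univ, (σ1 - σ2 - (σ3 - σ4)) t = 0 := by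
    apply hind
    rw [comb_sub, comb_sub, comb_sub, ← h1, ← h2, ← h3, ← h4]
    abel
  have key : ∀ a b c d : ZMod 3, a ≠ 0 → b ≠ 0 → c ≠ 0 → d ≠ 0 → a - b - (c - d) = 0 →
      c - a ≠ 0 → b - a = 0 := by decide
  have hduv : T.pt u - T.pt v = T.comb Set.univ ((σ3 - σ1) - (σ2 - σ1)) := by
    rw [comb_sub, ← hd1, ← hd2]; abel
  have hcc := T.col_comb hc ((σ3 - σ1) - (σ2 - σ1))
  rw [← hduv] at hcc
  have hsub : T.Subgraph S F := (T.tree_ind (fun _ _ => True) (by simp) (by simp) hP).1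
  obtain ⟨ω, hω⟩ := T.comb_span hP c (fun f _ => hc f (Set.mem_univ f)) (T.pt u - T.pt v) (by
    constructor
    · intro x hx
      have hxa : x ≠ u := by rintro rfl; exact hx hu
      have hxb : x ≠ v := by rintro rfl; exact hx hv
      simp [pt, hxa, hxb]
    · simp [sum_pt]) hcc
  have hω' : T.comb F ω = T.comb Set.univ (fun t => if t ∈ T.cliq F then ω t else 0) := by
    rw [comb, comb]
    symm
    rw [← Finset.sum_subset (T.cliq_mono (Set.subset_univ F))]
    · exact Finset.sum_congr rfl fun t ht => by simp [ht]
    · intro t _ ht; simp [ht]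
  have heq := hind (((σ3 - σ1) - (σ2 - σ1)) - (fun t => if t ∈ T.cliq F then ω t else 0)) (by
    rw [comb_sub, ← hω', ← hω, ← hduv, sub_self])
  have huw : w ≠ u := by rintro rfl; exact hw hu
  have hww := congrFun hd1 w
  have : ∃ t ∈ T.cliq Set.univ, (σ3 - σ1) t * T.ind t w ≠ 0 := by
    by_contra! hall
    have h0 : T.comb Set.univ (σ3 - σ1) w = 0 := by
      simp only [comb, Finset.sum_apply]
      exact Finset.sum_eq_zero hall
    rw [h0] at hww
    simp [pt, huw] at hww
  obtain ⟨t, ht, hne⟩ := this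
  have hwt : w ∈ t := by
    by_contra hwt
    exact hne (by simp [ind, hwt])
  have hτ : σ3 t - σ1 t ≠ 0 := fun h0 => hne (by simp [h0])
  have hρ := key _ _ _ _ (n1 t) (n2 t) (n3 t) (n4 t) (h1234 t ht) hτ
  have := heq t ht
  simp only [Pi.sub_apply, hρ, sub_zero] at this
  by_cases htF : t ∈ T.cliq F
  · exact hw (T.cliq_sub hsub htF hwt)
  · simp only [htF, if_false, sub_zero] at this
    exact hτ this

lemma bd_z3 (G : Multigraph) {β : G.V → ZMod 3} (h : G.Bd Set.univ β) :
    ∃ D : G.E → G.V × G.V, G.IsOrientation D ∧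
      ∀ v : G.V, ((G.outDeg D v : ZMod 3) - (G.inDeg D v : ZMod 3)) = β v := by
  obtain ⟨g, hg, hs⟩ := h
  choose x y hxy hgxy using hg
  refine ⟨fun e => (x e, y e), hxy, fun v => ?_⟩
  rw [← hs]
  simp only [outDeg, inDeg, Set.ncard_eq_toFinset_card', Set.toFinset_ofPred, Set.mem_univ, if_true,
    Finset.sum_apply, hgxy, Pi.sub_apply, Finset.sum_sub_distrib, pt, Finset.sum_boole]
  simp only [eq_comm]

end Multigraph

/-- Let `T` be a triangle-tree and `u, v, w` vertices of `T`. If `w`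
does not belong to the (unique) shortest triangle-path of `T` containing `u` and `v`,
then `T + uw + vw` is `Z3`-connected. -/
theorem stmt_8 (T T' : Multigraph) (hT : T.IsTriangleTree Set.univ Set.univ)
    (u v w : T.V) (S : Set T.V) (F : Set T.E)
    (hP : T.IsTrianglePath S F) (hu : u ∈ S) (hv : v ∈ S)
    (hmin : ∀ (S' : Set T.V) (F' : Set T.E),
      T.IsTrianglePath S' F' → u ∈ S' → v ∈ S' → S.ncard ≤ S'.ncard)
    (hw : w ∉ S)
    (hAdd : T.IsAddTwoEdges s(u, w) s(v, w) T') :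
    T'.Z3Connected := by
  obtain ⟨φ, e1, e2, h12, h1, h2, ψ, hψ, hr, hends⟩ := hAdd
  intro β hβ
  apply Multigraph.bd_z3
  have hβ' : ∑ x, (β ∘ φ) x = 0 := by
    rw [← hβ]; exact Equiv.sum_comp φ β
  obtain ⟨p, q, hp, hq, g, hg, hs⟩ := T.core hT u v w S F hP.1 hu hv hw (β ∘ φ) hβ'
  have hptφ : ∀ x : T.V, (T.pt x) ∘ φ.symm = T'.pt (φ x) := by
    intro x
    ext z
    simp [Multigraph.pt, Equiv.symm_apply_eq]
  -- the boundary realized by the edges coming from `T`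
  have hB : T'.Bd (Set.range ψ) (β + p • (T'.pt (φ u) - T'.pt (φ w))
      + q • (T'.pt (φ v) - T'.pt (φ w))) := by
    choose g0 hg0 using T'.exists_or
    refine ⟨fun e => if h : e ∈ Set.range ψ then g h.choose ∘ φ.symm else g0 e, ?_, ?_⟩
    · intro e
      by_cases h : e ∈ Set.range ψ
      · obtain ⟨x, y, hxy, hgx⟩ := hg h.choose
        refine ⟨φ x, φ y, ?_, ?_⟩
        · conv_lhs => rw [← h.choose_spec]
          rw [hends, hxy]; rfl
        · simp only [h, dif_pos]
          rw [hgx, ← hptφ, ← hptφ]; rfl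
      · simp only [h, dif_neg, not_false_eq_true]
        exact hg0 e
    · have hval : ∀ e, (if h : ψ e ∈ Set.range ψ then g h.choose ∘ φ.symm else g0 (ψ e))
          = g e ∘ φ.symm := by
        intro e
        have h : ψ e ∈ Set.range ψ := ⟨e, rfl⟩
        rw [dif_pos h, hψ h.choose_spec]
      rw [← Finset.sum_subset (Finset.subset_univ (Finset.univ.image ψ))]
      · rw [Finset.sum_image (fun a _ b _ hab => hψ hab)]
        refine (Finset.sum_congr rfl (g := fun e => g e ∘ φ.symm) fun e _ =>
          (if_pos ⟨e, rfl⟩).trans (hval e)).trans ?_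
        rw [← hptφ, ← hptφ, ← hptφ]
        ext z
        have hz := congrFun hs (φ.symm z)
        simpa using hz
      · intro e _ he
        rw [if_neg]
        rintro ⟨e', rfl⟩
        exact he (by simp)
  have huniv : (Set.univ : Set T'.E) = insert e1 (insert e2 (Set.range ψ)) := by
    rw [hr]; ext e; simp; tauto
  have hn2 : e2 ∉ Set.range ψ := by rw [hr]; simp
  have hn1 : e1 ∉ insert e2 (Set.range ψ) := by rw [hr]; simp [h12]
  have h1 : T'.ends e1 = s(φ u, φ w) := h1
  have h2 : T'.ends e2 = s(φ v, φ w) := h2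
  have h1' := h1.trans Sym2.eq_swap
  have h2' := h2.trans Sym2.eq_swap
  rw [huniv]
  rcases hp with rfl | rfl <;> rcases hq with rfl | rfl
  · convert T'.bd_insert hn1 h1' (T'.bd_insert hn2 h2' hB) using 1
    simp only [one_smul]; abel
  · convert T'.bd_insert hn1 h1' (T'.bd_insert hn2 h2 hB) using 1
    simp only [one_smul, neg_smul]; abel
  · convert T'.bd_insert hn1 h1 (T'.bd_insert hn2 h2' hB) using 1
    simp only [one_smul, neg_smul]; abel
  · convert T'.bd_insert hn1 h1 (T'.bd_insert hn2 h2 hB) using 1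
    simp only [one_smul, neg_smul]; abel
end

section
/- Let G be a bull-growing of a graph G1. Then G has a nowhere-zero 3-flow if and only if G1 has a nowhere-zero 3-flow. -/
open scoped Classical

namespace BullFlow

/-- Signed incidence of an arc at a vertex. -/
noncomputable def inc {V : Type} (R : Type) [Ring R] (d : V × V) (v : V) : R :=
  (if d.1 = v then 1 else 0) - (if d.2 = v then 1 else 0)

/-- Indicator function of a vertex. -/
noncomputable def ind {V : Type} (R : Type) [Ring R] (p v : V) : R := if p = v then 1 else 0

lemma inc_eq {V : Type} (R : Type) [Ring R] (d : V × V) (v : V) :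
    inc R d v = ind R d.1 v - ind R d.2 v := rfl

lemma inc_swap {V : Type} (R : Type) [Ring R] (d : V × V) (v : V) :
    inc R d.swap v = - inc R d v := by simp [inc]

/-- Net outflow. -/
noncomputable def net (G : Multigraph) (D : G.E → G.V × G.V) (f : G.E → ℤ) (v : G.V) : ℤ :=
  ∑ e, f e * inc ℤ (D e) v

lemma conserving_iff (G : Multigraph) (D : G.E → G.V × G.V) (f : G.E → ℤ) :
    G.IsConserving D f ↔ ∀ v, net G D f v = 0 := by
  unfold Multigraph.IsConserving net inc
  refine forall_congr' fun v => ?_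
  simp only [mul_sub, mul_ite, mul_one, mul_zero, Finset.sum_sub_distrib, sub_eq_zero]

lemma sum_ind (G : Multigraph) (S : Finset G.V) (p : G.V) :
    ∑ v ∈ S, ind ℤ p v = if p ∈ S then 1 else 0 := by
  simp [ind]

/-- Augmenting set: either a set of arcs from a positive vertex to `y`. -/
lemma augment (G : Multigraph) (D : G.E → G.V × G.V) (f : G.E → ℤ)
    (hf : ∀ e, 0 < f e) (y : G.V) (hy : net G D f y < 0) :
    ∃ (x : G.V) (F : Finset G.E), 0 < net G D f x ∧
      ∀ v, ∑ e ∈ F, inc ℤ (D e) v = ind ℤ x v - ind ℤ y v := by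
  let Good : Finset G.V → Prop := fun S => y ∈ S ∧ ∀ x ∈ S, ∃ F : Finset G.E,
    (∀ e ∈ F, (D e).1 ∈ S) ∧ ∀ v, ∑ e ∈ F, inc ℤ (D e) v = ind ℤ x v - ind ℤ y v
  have h0 : Good {y} := by
    refine ⟨by simp, fun x hx => ⟨∅, by simp, ?_⟩⟩
    simp at hx
    simp [hx]
  obtain ⟨S, hS⟩ := (Set.toFinite {S | Good S}).exists_maximal ⟨_, h0⟩
  have hG : Good S := hS.1
  have hclosed : ∀ e, (D e).2 ∈ S → (D e).1 ∈ S := by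
    intro e h2
    by_contra h1
    have : Good (insert (D e).1 S) := by
      refine ⟨Finset.mem_insert_of_mem hG.1, fun x hx => ?_⟩
      rcases Finset.mem_insert.1 hx with rfl | hx
      · obtain ⟨F, hF1, hF2⟩ := hG.2 _ h2
        have he : e ∉ F := fun h => h1 (hF1 e h)
        refine ⟨insert e F, ?_, ?_⟩
        · intro e' he'
          rcases Finset.mem_insert.1 he' with rfl | he'
          · simp
          · exact Finset.mem_insert_of_mem (hF1 _ he')
        · intro v
          rw [Finset.sum_insert he, hF2, inc_eq]; ring
      · obtain ⟨F, hF1, hF2⟩ := hG.2 _ hx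
        exact ⟨F, fun e he => Finset.mem_insert_of_mem (hF1 e he), hF2⟩
    have h3 : insert (D e).1 S ≤ S := hS.2 this (Finset.subset_insert _ _)
    exact h1 (h3 (Finset.mem_insert_self _ _))
  have hsum : 0 ≤ ∑ v ∈ S, net G D f v := by
    unfold net
    rw [Finset.sum_comm]
    refine Finset.sum_nonneg fun e _ => ?_
    rw [← Finset.mul_sum]
    refine mul_nonneg (hf e).le ?_
    simp only [inc_eq, Finset.sum_sub_distrib, sum_ind]
    have := hclosed e
    split_ifs <;> simp_all
  by_contra hcon
  push Not at hcon
  have hneg : ∀ x ∈ S, net G D f x ≤ 0 := by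
    intro x hx
    by_contra hx'
    obtain ⟨F, _, hF⟩ := hG.2 x hx
    obtain ⟨v, hv⟩ := hcon x F (by omega)
    exact hv (hF v)
  have := Finset.sum_lt_sum (s := S) (f := net G D f) (g := fun _ => 0) hneg ⟨y, hG.1, hy⟩
  simp at this
  omega

lemma sum_net (G : Multigraph) (D : G.E → G.V × G.V) (f : G.E → ℤ) :
    ∑ v, net G D f v = 0 := by
  unfold net
  rw [Finset.sum_comm]
  refine Finset.sum_eq_zero fun e _ => ?_
  rw [← Finset.mul_sum]
  simp [inc_eq, Finset.sum_sub_distrib, sum_ind]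

lemma tutte (G : Multigraph) (n : ℕ) : ∀ (D : G.E → G.V × G.V) (f : G.E → ℤ),
    G.IsOrientation D → (∀ e, f e = 1 ∨ f e = 2) → (∀ v, (3 : ℤ) ∣ net G D f v) →
    (∑ v, (net G D f v).natAbs = n) → G.HasNZ3Flow := by
  induction n using Nat.strong_induction_on with
  | _ n ih =>
  intro D f hD hf h3 hn
  by_cases hz : ∀ v, net G D f v = 0
  · refine ⟨D, f, hD, fun e => ?_, (conserving_iff G D f).2 hz⟩
    rcases hf e with h | h <;> rw [h] <;> norm_num
  · have hy : ∃ y, net G D f y < 0 := by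
      by_contra hc
      push Not at hc
      exact hz fun v => (Finset.sum_eq_zero_iff_of_nonneg (fun v _ => hc v)).1
        (sum_net G D f) v (Finset.mem_univ v)
    obtain ⟨y, hy⟩ := hy
    obtain ⟨x, F, hx, hF⟩ := augment G D f (fun e => by rcases hf e with h | h <;> omega) y hy
    let D' : G.E → G.V × G.V := fun e => if e ∈ F then (D e).swap else D e
    let f' : G.E → ℤ := fun e => if e ∈ F then 3 - f e else f e
    have hnet : ∀ v, net G D' f' v = net G D f v - 3 * (ind ℤ x v - ind ℤ y v) := by
      intro v
      rw [← hF v, net, net, Finset.mul_sum]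
      have : ∑ e ∈ F, 3 * inc ℤ (D e) v = ∑ e, if e ∈ F then 3 * inc ℤ (D e) v else 0 := by
        simp
      rw [this, ← Finset.sum_sub_distrib]
      refine Finset.sum_congr rfl fun e _ => ?_
      by_cases he : e ∈ F
      · simp only [D', f', he, if_true, inc_swap]; ring
      · simp [D', f', he]
    have hxy : x ≠ y := by rintro rfl; omega
    have hle : ∀ v, (net G D' f' v).natAbs ≤ (net G D f v).natAbs := by
      intro v
      rw [hnet]
      have := h3 v
      unfold ind
      split_ifs with h1 h2 h2
      · exact absurd (h1.trans h2.symm) hxy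
      · subst h1; omega
      · subst h2; omega
      · simp
    have hlt : (net G D' f' x).natAbs < (net G D f x).natAbs := by
      rw [hnet]
      have := h3 x
      simp only [ind, if_true, if_neg hxy.symm]
      omega
    refine ih (∑ v, (net G D' f' v).natAbs) ?_ D' f' ?_ ?_ ?_ rfl
    · rw [← hn]
      exact Finset.sum_lt_sum (fun v _ => hle v) ⟨x, Finset.mem_univ x, hlt⟩
    · intro e
      by_cases he : e ∈ F
      · simp only [D', he, if_true]; rw [hD e]; exact Sym2.eq_swap
      · simp only [D', he, if_false]; exact hD e
    · intro e
      have := hf e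
      by_cases he : e ∈ F <;> simp only [f', he, if_true, if_false] <;> omega
    · intro v
      rw [hnet]
      exact dvd_sub (h3 v) (dvd_mul_right _ _)

/-- Mod 3 orientation. -/
def M3 (G : Multigraph) : Prop :=
  ∃ D : G.E → G.V × G.V, G.IsOrientation D ∧ ∀ v, ∑ e, inc (ZMod 3) (D e) v = 0

lemma inc_cast {V : Type} (d : V × V) (v : V) : ((inc ℤ d v : ℤ) : ZMod 3) = inc (ZMod 3) d v := by
  simp [inc]

lemma nz_iff (G : Multigraph) : G.HasNZ3Flow ↔ M3 G := by
  constructor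
  · rintro ⟨D, f, hD, hf, hc⟩
    rw [conserving_iff] at hc
    refine ⟨fun e => if f e = 1 ∨ f e = -2 then D e else (D e).swap, fun e => ?_, fun v => ?_⟩
    · dsimp only
      split_ifs
      · exact hD e
      · rw [hD e]; exact Sym2.eq_swap
    · have := congrArg (Int.cast : ℤ → ZMod 3) (hc v)
      rw [net, Int.cast_sum] at this
      rw [← Int.cast_zero, ← this]
      refine Finset.sum_congr rfl fun e _ => ?_
      rw [Int.cast_mul, inc_cast]
      obtain ⟨h1, h2⟩ := hf e
      have h4 : f e = 1 ∨ f e = -2 ∨ f e = -1 ∨ f e = 2 := by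
        rcases abs_cases (f e) with h | h <;> omega
      have e1 : ((-2 : ℤ) : ZMod 3) = 1 := by decide
      have e2 : ((2 : ℤ) : ZMod 3) = -1 := by decide
      dsimp only
      rcases h4 with h | h | h | h
      · rw [if_pos (Or.inl h), h]; simp
      · rw [if_pos (Or.inr h), h, e1]; simp
      · rw [if_neg (by omega), h, inc_swap]; simp
      · rw [if_neg (by omega), h, e2, inc_swap]; simp
  · rintro ⟨D, hD, h⟩
    refine tutte G _ D (fun _ => 1) hD (fun _ => Or.inl rfl) (fun v => ?_) rfl
    have : ((net G D (fun _ => 1) v : ℤ) : ZMod 3) = 0 := by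
      rw [← h v, net, Int.cast_sum]
      simp [inc_cast]
    exact (ZMod.intCast_zmod_eq_zero_iff_dvd _ 3).1 this

lemma exists_sign {V : Type} (d : V × V) (p q : V) (h : s(p, q) = s(d.1, d.2)) :
    ∃ s : ZMod 3, (s = 1 ∨ s = -1) ∧
      ∀ v, inc (ZMod 3) d v = s * (ind (ZMod 3) p v - ind (ZMod 3) q v) := by
  rcases Sym2.eq_iff.1 h with ⟨rfl, rfl⟩ | ⟨rfl, rfl⟩
  · exact ⟨1, Or.inl rfl, fun v => by rw [inc_eq]; ring⟩
  · exact ⟨-1, Or.inr rfl, fun v => by rw [inc_eq]; ring⟩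

lemma exists_arc {V : Type} (p q : V) (s : ZMod 3) (hs : s = 1 ∨ s = -1) :
    ∃ d : V × V, s(p, q) = s(d.1, d.2) ∧
      ∀ v, inc (ZMod 3) d v = s * (ind (ZMod 3) p v - ind (ZMod 3) q v) := by
  rcases hs with rfl | rfl
  · exact ⟨(p, q), rfl, fun v => by rw [inc_eq]; ring⟩
  · exact ⟨(q, p), Sym2.eq_swap, fun v => by rw [inc_eq]; ring⟩

lemma inc_zero {V : Type} (d : V × V) (x : V) (h : x ∉ s(d.1, d.2)) : inc (ZMod 3) d x = 0 := by
  rw [Sym2.mem_iff] at h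
  push Not at h
  simp [inc, h.1.symm, h.2.symm]

lemma inc_map {V W : Type} (φ : V → W) (hφ : Function.Injective φ) (d : V × V) (x : V) :
    inc (ZMod 3) (Prod.map φ φ d) (φ x) = inc (ZMod 3) d x := by
  simp [inc, hφ.eq_iff]

/-- Boundary condition outside the bull. -/
def P (G : Multigraph) (X : Finset G.E) (u v a b : G.V) : Prop :=
  ∃ D : G.E → G.V × G.V, G.IsOrientation D ∧ ∃ s : ZMod 3, (s = 1 ∨ s = -1) ∧
    ∀ x, x ≠ u → x ≠ v →
      ∑ e ∈ Xᶜ, inc (ZMod 3) (D e) x = s * (ind (ZMod 3) a x - ind (ZMod 3) b x)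

lemma exists_orientation (G : Multigraph) : ∃ D, G.IsOrientation D := by
  have : ∀ e : G.E, ∃ d : G.V × G.V, G.ends e = s(d.1, d.2) := by
    intro e
    induction h : G.ends e with
    | _ p q => exact ⟨(p, q), rfl⟩
  choose D hD using this
  exact ⟨D, hD⟩

lemma m3_iff_P (G : Multigraph) (u v w a b : G.V) (euv euw evw eua evb : G.E)
    (h1 : G.ends euv = s(u, v)) (h2 : G.ends euw = s(u, w)) (h3 : G.ends evw = s(v, w))
    (h4 : G.ends eua = s(u, a)) (h5 : G.ends evb = s(v, b))
    (hav : a ≠ v) (hbu : b ≠ u)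
    (n1 : euv ≠ euw) (n2 : euv ≠ eua) (n3 : euw ≠ eua)
    (n4 : euv ≠ evw) (n5 : euv ≠ evb) (n6 : evw ≠ evb)
    (hu : {e : G.E | u ∈ G.ends e} = {euv, euw, eua})
    (hv : {e : G.E | v ∈ G.ends e} = {euv, evw, evb}) :
    M3 G ↔ P G {euv, euw, evw, eua, evb} u v a b := by
  have huv : u ≠ v := by have := G.loopless euv; rw [h1] at this; simpa using this
  have huw : u ≠ w := by have := G.loopless euw; rw [h2] at this; simpa using this
  have hvw : v ≠ w := by have := G.loopless evw; rw [h3] at this; simpa using this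
  have hua : u ≠ a := by have := G.loopless eua; rw [h4] at this; simpa using this
  have hvb : v ≠ b := by have := G.loopless evb; rw [h5] at this; simpa using this
  have m1 : euw ≠ evw := by
    rintro rfl
    have : u ∈ s(v, w) := by rw [← h3, h2]; simp
    simp [huv, huw] at this
  have m2 : euw ≠ evb := by
    rintro rfl
    have : u ∈ s(v, b) := by rw [← h5, h2]; simp
    simp [huv, hbu.symm] at this
  have m3 : evw ≠ eua := by
    rintro rfl
    have : u ∈ s(v, w) := by rw [← h3, h4]; simp
    simp [huv, huw] at this
  have m4 : eua ≠ evb := by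
    rintro rfl
    have : u ∈ s(v, b) := by rw [← h5, h4]; simp
    simp [huv, hbu.symm] at this
  set X : Finset G.E := {euv, euw, evw, eua, evb} with hX
  have hsplit : ∀ (D : G.E → G.V × G.V) x, ∑ e, inc (ZMod 3) (D e) x =
      (inc (ZMod 3) (D euv) x + inc (ZMod 3) (D euw) x + inc (ZMod 3) (D evw) x
        + inc (ZMod 3) (D eua) x + inc (ZMod 3) (D evb) x)
      + ∑ e ∈ Xᶜ, inc (ZMod 3) (D e) x := by
    intro D x
    rw [← Finset.sum_add_sum_compl X, hX, Finset.sum_insert (by simp [*]),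
      Finset.sum_insert (by simp [*]), Finset.sum_insert (by simp [*]),
      Finset.sum_insert (by simp [*]), Finset.sum_singleton]
    ring
  have hu0 : ∀ D, G.IsOrientation D → ∑ e ∈ Xᶜ, inc (ZMod 3) (D e) u = 0 := by
    intro D hD
    refine Finset.sum_eq_zero fun e he => inc_zero _ _ ?_
    rw [← hD e]
    intro hmem
    have : e ∈ ({euv, euw, eua} : Set G.E) := hu ▸ hmem
    simp [hX] at he this
    tauto
  have hv0 : ∀ D, G.IsOrientation D → ∑ e ∈ Xᶜ, inc (ZMod 3) (D e) v = 0 := by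
    intro D hD
    refine Finset.sum_eq_zero fun e he => inc_zero _ _ ?_
    rw [← hD e]
    intro hmem
    have : e ∈ ({euv, evw, evb} : Set G.E) := hv ▸ hmem
    simp [hX] at he this
    tauto
  have h3z : (3 : ZMod 3) = 0 := by decide
  constructor
  · rintro ⟨D, hD, hs⟩
    obtain ⟨s1, t1, c1⟩ := exists_sign (D euv) u v (by rw [← h1, hD])
    obtain ⟨s2, t2, c2⟩ := exists_sign (D euw) u w (by rw [← h2, hD])
    obtain ⟨s3, t3, c3⟩ := exists_sign (D evw) v w (by rw [← h3, hD])
    obtain ⟨s4, t4, c4⟩ := exists_sign (D eua) u a (by rw [← h4, hD])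
    obtain ⟨s5, t5, c5⟩ := exists_sign (D evb) v b (by rw [← h5, hD])
    have eu := hs u
    have ev := hs v
    rw [hsplit, hu0 D hD, c1, c2, c3, c4, c5] at eu
    rw [hsplit, hv0 D hD, c1, c2, c3, c4, c5] at ev
    simp [ind, huv, huv.symm, huw.symm, hvw.symm, hua.symm, hvb.symm, hav, hbu] at eu ev
    have key : s2 = s1 ∧ s4 = s1 ∧ s3 = -s1 ∧ s5 = -s1 := by
      clear c1 c2 c3 c4 c5
      rcases t1 with rfl | rfl <;> rcases t2 with rfl | rfl <;> rcases t3 with rfl | rfl <;>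
        rcases t4 with rfl | rfl <;> rcases t5 with rfl | rfl <;>
        first
        | exact absurd eu (by decide)
        | exact absurd ev (by decide)
        | exact ⟨by decide, by decide, by decide, by decide⟩
    obtain ⟨rfl, rfl, rfl, rfl⟩ := key
    refine ⟨D, hD, s4, t1, fun x hxu hxv => ?_⟩
    have ex := hs x
    rw [hsplit, c1, c2, c3, c4, c5] at ex
    have i1 : ind (ZMod 3) u x = 0 := by simp [ind, hxu.symm]
    have i2 : ind (ZMod 3) v x = 0 := by simp [ind, hxv.symm]
    rw [i1, i2] at ex
    linear_combination ex
  · rintro ⟨D, hD, s, hs, hb⟩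
    have hs' : -s = 1 ∨ -s = -1 := by rcases hs with rfl | rfl <;> simp
    obtain ⟨d1, t1, c1⟩ := exists_arc u v s hs
    obtain ⟨d2, t2, c2⟩ := exists_arc u w s hs
    obtain ⟨d3, t3, c3⟩ := exists_arc v w (-s) hs'
    obtain ⟨d4, t4, c4⟩ := exists_arc u a s hs
    obtain ⟨d5, t5, c5⟩ := exists_arc v b (-s) hs'
    let D' : G.E → G.V × G.V := fun e => if e = euv then d1 else if e = euw then d2
      else if e = evw then d3 else if e = eua then d4 else if e = evb then d5 else D e
    have q1 : D' euv = d1 := by simp [D']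
    have q2 : D' euw = d2 := by simp [D', n1.symm]
    have q3 : D' evw = d3 := by simp [D', n4.symm, m1.symm]
    have q4 : D' eua = d4 := by simp [D', n2.symm, n3.symm, m3.symm]
    have q5 : D' evb = d5 := by simp [D', n5.symm, m2.symm, n6.symm, m4.symm]
    have q6 : ∀ e, e ∉ X → D' e = D e := by
      intro e he
      simp [hX] at he
      simp [D', he]
    have hD' : G.IsOrientation D' := by
      intro e
      by_cases he : e ∈ X
      · simp only [hX, Finset.mem_insert, Finset.mem_singleton] at he
        rcases he with rfl | rfl | rfl | rfl | rfl
        · rw [q1, h1, t1]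
        · rw [q2, h2, t2]
        · rw [q3, h3, t3]
        · rw [q4, h4, t4]
        · rw [q5, h5, t5]
      · rw [q6 e he]; exact hD e
    refine ⟨D', hD', fun x => ?_⟩
    rw [hsplit, q1, q2, q3, q4, q5, c1, c2, c3, c4, c5]
    by_cases hxu : x = u
    · subst hxu
      rw [hu0 D' hD']
      simp [ind, huv.symm, huw.symm, hua.symm, hbu]
      linear_combination s * h3z
    by_cases hxv : x = v
    · subst hxv
      rw [hv0 D' hD']
      simp [ind, huv, hvw.symm, hvb.symm, hav]
      linear_combination -s * h3z
    have i1 : ind (ZMod 3) u x = 0 := by simp [ind, Ne.symm hxu]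
    have i2 : ind (ZMod 3) v x = 0 := by simp [ind, Ne.symm hxv]
    have : ∑ e ∈ Xᶜ, inc (ZMod 3) (D' e) x = ∑ e ∈ Xᶜ, inc (ZMod 3) (D e) x :=
      Finset.sum_congr rfl fun e he => by rw [q6 e (Finset.mem_compl.1 he)]
    rw [this, hb x hxu hxv, i1, i2]
    ring

lemma sum_transfer (G H : Multigraph) (φ : H.V → G.V) (hφ : Function.Injective φ)
    (K : Finset H.E) (Y : Finset G.E) (ψ : H.E → G.E)
    (hinj : ∀ e ∈ K, ∀ e' ∈ K, ψ e = ψ e' → e = e')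
    (him : ∀ g, g ∈ Y ↔ ∃ e ∈ K, ψ e = g)
    (D : G.E → G.V × G.V) (D' : H.E → H.V × H.V)
    (h : ∀ e ∈ K, D (ψ e) = Prod.map φ φ (D' e)) (x : H.V) :
    ∑ e ∈ K, inc (ZMod 3) (D' e) x = ∑ e ∈ Y, inc (ZMod 3) (D e) (φ x) := by
  refine Finset.sum_bij (fun e _ => ψ e) (fun e he => (him _).2 ⟨e, he, rfl⟩)
    (fun e he e' he' => hinj e he e' he') (fun g hg => ?_) (fun e he => ?_)
  · obtain ⟨e, he, rfl⟩ := (him g).1 hg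
    exact ⟨e, he, rfl⟩
  · rw [h e he, inc_map φ hφ]

lemma pull (G H : Multigraph) (φ : H.V → G.V) (K : Finset H.E) (ψ : H.E → G.E)
    (hends : ∀ e ∈ K, G.ends (ψ e) = Sym2.map φ (H.ends e))
    (D : G.E → G.V × G.V) (hD : G.IsOrientation D) :
    ∃ D' : H.E → H.V × H.V, H.IsOrientation D' ∧ ∀ e ∈ K, D (ψ e) = Prod.map φ φ (D' e) := by
  have : ∀ e, ∃ d : H.V × H.V, H.ends e = s(d.1, d.2) ∧
      (e ∈ K → D (ψ e) = Prod.map φ φ d) := by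
    intro e
    by_cases he : e ∈ K
    · have h := hends e he
      rw [hD] at h
      induction hh : H.ends e with
      | _ p q =>
      rw [hh, Sym2.map_mk] at h
      rcases Sym2.eq_iff.1 h with ⟨h1, h2⟩ | ⟨h1, h2⟩
      · exact ⟨(p, q), rfl, fun _ => Prod.ext h1 h2⟩
      · exact ⟨(q, p), Sym2.eq_swap, fun _ => Prod.ext h1 h2⟩
    · obtain ⟨D0, hD0⟩ := exists_orientation H
      exact ⟨D0 e, hD0 e, fun h => absurd h he⟩
  choose D' h1 h2 using this
  exact ⟨D', h1, h2⟩

lemma push (G H : Multigraph) (φ : H.V → G.V) (K : Finset H.E) (ψ : H.E → G.E)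
    (hinj : ∀ e ∈ K, ∀ e' ∈ K, ψ e = ψ e' → e = e')
    (hends : ∀ e ∈ K, G.ends (ψ e) = Sym2.map φ (H.ends e))
    (D' : H.E → H.V × H.V) (hD' : H.IsOrientation D') :
    ∃ D : G.E → G.V × G.V, G.IsOrientation D ∧ ∀ e ∈ K, D (ψ e) = Prod.map φ φ (D' e) := by
  have : ∀ g, ∃ d : G.V × G.V, G.ends g = s(d.1, d.2) ∧
      (∀ e ∈ K, ψ e = g → d = Prod.map φ φ (D' e)) := by
    intro g
    by_cases hg : ∃ e ∈ K, ψ e = g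
    · obtain ⟨e, he, rfl⟩ := hg
      refine ⟨Prod.map φ φ (D' e), ?_, fun e' he' h => ?_⟩
      · rw [hends e he, hD' e]; rfl
      · rw [hinj _ he' _ he h]
    · obtain ⟨D0, hD0⟩ := exists_orientation G
      exact ⟨D0 g, hD0 g, fun e he h => absurd ⟨e, he, h⟩ hg⟩
  choose D h1 h2 using this
  exact ⟨D, h1, fun e he => h2 _ e he rfl⟩

end BullFlow

/-- Let `G` be a bull-growing of `G1`. Then `G` has a nowhere-zero
3-flow iff `G1` has one. -/
theorem stmt_11 (G G1 : Multigraph) (h : G.IsBullGrowing G1) :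
    G.HasNZ3Flow ↔ G1.HasNZ3Flow := by
  open BullFlow in
  obtain ⟨u, v, w, a, b, euv, euw, evw, eua, evb, h1, h2, h3, h4, h5, hav, hbu, n1, n2, n3,
    n4, n5, n6, hu, hv, φ, hφ, hr, hA, hB⟩ := h
  rw [nz_iff, nz_iff, m3_iff_P G u v w a b euv euw evw eua evb h1 h2 h3 h4 h5 hav hbu n1 n2 n3
    n4 n5 n6 hu hv]
  have hxr : ∀ x, φ x ≠ u ∧ φ x ≠ v := by
    intro x
    have : φ x ∈ Set.range φ := ⟨x, rfl⟩
    rw [hr] at this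
    exact this
  have hrx : ∀ x, x ≠ u → x ≠ v → ∃ y, φ y = x := by
    intro x h1 h2
    have : x ∈ Set.range φ := by rw [hr]; exact ⟨h1, h2⟩
    exact this
  by_cases hab : a = b
  · obtain ⟨ψ, hψ, hψr, he⟩ := hA hab
    have hinj : ∀ e ∈ (Finset.univ : Finset G1.E), ∀ e' ∈ (Finset.univ : Finset G1.E),
      ψ e = ψ e' → e = e' := fun e _ e' _ h => hψ h
    have hends : ∀ e ∈ (Finset.univ : Finset G1.E), G.ends (ψ e) = Sym2.map φ (G1.ends e) :=
      fun e _ => he e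
    have him : ∀ g, g ∈ ({euv, euw, evw, eua, evb} : Finset G.E)ᶜ ↔
        ∃ e ∈ (Finset.univ : Finset G1.E), ψ e = g := by
      intro g
      have := Set.ext_iff.1 hψr g
      simp at this
      simp [this]
    constructor
    · rintro ⟨D, hD, s, hs, hb⟩
      obtain ⟨D', hD', hc⟩ := pull G G1 φ _ ψ hends D hD
      refine ⟨D', hD', fun x => ?_⟩
      rw [sum_transfer G G1 φ hφ _ _ ψ hinj him D D' hc, hb _ (hxr x).1 (hxr x).2, hab]
      ring
    · rintro ⟨D', hD', hb⟩
      obtain ⟨D, hD, hc⟩ := push G G1 φ _ ψ hinj hends D' hD'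
      refine ⟨D, hD, 1, Or.inl rfl, fun x hxu hxv => ?_⟩
      obtain ⟨y, rfl⟩ := hrx x hxu hxv
      rw [← sum_transfer G G1 φ hφ _ _ ψ hinj him D D' hc, hb, hab]
      ring
  · obtain ⟨e0, ψ, hab0, hψ, hψr, he⟩ := hB hab
    have hK : ∀ e, e ∈ ({e0} : Finset G1.E)ᶜ ↔ e ≠ e0 := by simp
    have hinj : ∀ e ∈ ({e0} : Finset G1.E)ᶜ, ∀ e' ∈ ({e0} : Finset G1.E)ᶜ,
      ψ e = ψ e' → e = e' := fun e h e' h' hh => hψ ((hK e).1 h) ((hK e').1 h') hh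
    have hends : ∀ e ∈ ({e0} : Finset G1.E)ᶜ, G.ends (ψ e) = Sym2.map φ (G1.ends e) :=
      fun e h => he e ((hK e).1 h)
    have him : ∀ g, g ∈ ({euv, euw, evw, eua, evb} : Finset G.E)ᶜ ↔
        ∃ e ∈ ({e0} : Finset G1.E)ᶜ, ψ e = g := by
      intro g
      have := Set.ext_iff.1 hψr g
      simp at this
      simp [this]
    obtain ⟨a', b', rfl, rfl, hab'⟩ : ∃ a' b', φ a' = a ∧ φ b' = b ∧ G1.ends e0 = s(a', b') := by
      induction hh : G1.ends e0 with
      | _ p q =>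
      rw [hh, Sym2.map_mk] at hab0
      rcases Sym2.eq_iff.1 hab0 with ⟨h1, h2⟩ | ⟨h1, h2⟩
      · exact ⟨p, q, h1, h2, rfl⟩
      · exact ⟨q, p, h2, h1, Sym2.eq_swap⟩
    have hind : ∀ p x, ind (ZMod 3) (φ p) (φ x) = ind (ZMod 3) p x := by
      intro p x; simp [ind, hφ.eq_iff]
    constructor
    · rintro ⟨D, hD, s, hs, hb⟩
      obtain ⟨D', hD', hc⟩ := pull G G1 φ _ ψ hends D hD
      have hs' : -s = 1 ∨ -s = -1 := by rcases hs with rfl | rfl <;> simp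
      obtain ⟨d, t, c⟩ := exists_arc a' b' (-s) hs'
      have hc2 : ∀ e ∈ ({e0} : Finset G1.E)ᶜ,
          D (ψ e) = Prod.map φ φ (Function.update D' e0 d e) := by
        intro e h
        rw [Function.update_of_ne ((hK e).1 h)]
        exact hc e h
      refine ⟨Function.update D' e0 d, fun e => ?_, fun x => ?_⟩
      · by_cases h : e = e0
        · subst h; rw [Function.update_self, hab', t]
        · rw [Function.update_of_ne h]; exact hD' e
      · rw [← Finset.sum_add_sum_compl {e0}, Finset.sum_singleton, Function.update_self,
          sum_transfer G G1 φ hφ _ _ ψ hinj him D _ hc2, hb _ (hxr x).1 (hxr x).2, c,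
          hind, hind]
        ring
    · rintro ⟨D', hD', hb⟩
      obtain ⟨D, hD, hc⟩ := push G G1 φ _ ψ hinj hends D' hD'
      obtain ⟨s, hs, c⟩ := exists_sign (D' e0) a' b' (by rw [← hab', hD'])
      have hs' : -s = 1 ∨ -s = -1 := by rcases hs with rfl | rfl <;> simp
      refine ⟨D, hD, -s, hs', fun x hxu hxv => ?_⟩
      obtain ⟨y, rfl⟩ := hrx x hxu hxv
      rw [← sum_transfer G G1 φ hφ _ _ ψ hinj him D D' hc, hind, hind]
      have := hb y
      rw [← Finset.sum_add_sum_compl {e0}, Finset.sum_singleton, c] at this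
      linear_combination this
end

section
/- Every finite loopless graph G (parallel edges allowed) with at least 4 vertices containing two edge-disjoint spanning triangle-trees belongs to the class S3; that is, for every Z3-boundary β of G there is a strongly connected orientation D of G such that the out-degree minus the in-degree of every vertex v under D is congruent to β(v) modulo 3. -/
open scoped Classical

namespace Multigraph
namespace TTP

variable {G : Multigraph}

/-- boundary of an arc -/
noncomputable def dd (a b : G.V) : G.V → ZMod 3 := Pi.single a 1 - Pi.single b 1

/-- sum-zero boundary supported on `S` -/
def Bd (S : Set G.V) (β : G.V → ZMod 3) : Prop := (∀ v, v ∉ S → β v = 0) ∧ ∑ v, β v = 0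

/-- `β` is realized by an orientation of `F` -/
def Real (F : Set G.E) (β : G.V → ZMod 3) : Prop :=
  ∃ D : G.E → G.V × G.V, G.IsOrientation D ∧
    (∑ e : G.E, if e ∈ F then dd (G := G) (D e).1 (D e).2 else 0) = β

def ZC (S : Set G.V) (F : Set G.E) : Prop := ∀ β, Bd S β → Real F β

def SO (S : Set G.V) (K : Set G.E) : Prop :=
  ∃ D : G.E → G.V × G.V, G.IsOrientation D ∧
    ∀ u ∈ S, ∀ v ∈ S, Relation.ReflTransGen (fun p q => ∃ e ∈ K, D e = (p, q)) u v

lemma dd_swap (a b : G.V) : dd b a = - dd a b := by simp [dd]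

lemma bd_dd {S : Set G.V} {a b : G.V} (ha : a ∈ S) (hb : b ∈ S) : Bd S (dd a b) := by
  refine ⟨fun v hv => ?_, ?_⟩
  · have h1 : v ≠ a := fun h => hv (h ▸ ha)
    have h2 : v ≠ b := fun h => hv (h ▸ hb)
    simp [dd, h1, h2]
  · simp [dd, Finset.sum_sub_distrib]

lemma Bd.add {S : Set G.V} {β γ : G.V → ZMod 3} (h : Bd S β) (h' : Bd S γ) : Bd S (β + γ) := by
  refine ⟨fun v hv => ?_, ?_⟩
  · simp [h.1 v hv, h'.1 v hv]
  · simp [Finset.sum_add_distrib, h.2, h'.2]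

lemma Bd.smul {S : Set G.V} {β : G.V → ZMod 3} (h : Bd S β) (k : ZMod 3) : Bd S (k • β) := by
  refine ⟨fun v hv => ?_, ?_⟩
  · simp [h.1 v hv]
  · simp [← Finset.mul_sum, h.2]

lemma Bd.sub {S : Set G.V} {β γ : G.V → ZMod 3} (h : Bd S β) (h' : Bd S γ) : Bd S (β - γ) := by
  have := h.add (h'.smul (-1)); simpa [sub_eq_add_neg] using this

lemma Bd.mono {S S' : Set G.V} {β : G.V → ZMod 3} (h : Bd S β) (hs : S ⊆ S') : Bd S' β :=
  ⟨fun v hv => h.1 v (fun h => hv (hs h)), h.2⟩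

/-- peel off a vertex -/
lemma Bd.peel {S : Set G.V} {β : G.V → ZMod 3} {v a b : G.V} (h : Bd (insert v S) β)
    (hv : v ∉ S) (ha : a ∈ S) (hb : b ∈ S) (k l : ZMod 3) (hk : k + l = β v) :
    Bd S (β - k • dd v a - l • dd v b) := by
  have ha' : v ≠ a := fun h => hv (h ▸ ha)
  have hb' : v ≠ b := fun h => hv (h ▸ hb)
  have H : Bd (insert v S) (β - k • dd v a - l • dd v b) :=
    (h.sub ((bd_dd (by simp) (by simp [ha])).smul k)).sub ((bd_dd (by simp) (by simp [hb])).smul l)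
  refine ⟨fun w hw => ?_, H.2⟩
  by_cases hwv : w = v
  · subst hwv
    simp [dd, ha', hb', ← hk]
  · exact H.1 w (by simp [hwv, hw])

lemma exists_or : ∃ D : G.E → G.V × G.V, G.IsOrientation D := by
  have : ∀ e : G.E, ∃ p : G.V × G.V, G.ends e = s(p.1, p.2) := by
    intro e
    induction h : G.ends e using Sym2.ind with
    | _ x y => exact ⟨(x, y), rfl⟩
  choose D hD using this
  exact ⟨D, hD⟩

lemma real_empty : Real (G := G) ∅ 0 := by
  obtain ⟨D, hD⟩ := exists_or (G := G)
  exact ⟨D, hD, by simp⟩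

lemma Real.ins1 {F : Set G.E} {β : G.V → ZMod 3} (h : Real F β) {e : G.E} (he : e ∉ F)
    {a b : G.V} (hab : G.ends e = s(a, b)) : Real (insert e F) (β + dd a b) := by
  obtain ⟨D, hD, hs⟩ := h
  refine ⟨Function.update D e (a, b), ?_, ?_⟩
  · intro f
    by_cases hf : f = e
    · subst hf; simpa using hab
    · simpa [hf] using hD f
  · rw [← hs]
    calc _ = ∑ f : G.E, ((if f ∈ F then dd (G := G) (D f).1 (D f).2 else 0) +
          (if f = e then dd a b else 0)) := by
            refine Finset.sum_congr rfl (fun f _ => ?_)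
            by_cases hf : f = e
            · subst hf; simp [he]
            · simp [hf]
      _ = _ := by rw [Finset.sum_add_distrib]; simp

lemma z3 (k : ZMod 3) : k = 0 ∨ k = 1 ∨ k = -1 := by revert k; decide

lemma Real.ins {F : Set G.E} {β : G.V → ZMod 3} {e : G.E} {a b : G.V} {k : ZMod 3}
    (h : Real F (β - k • dd a b)) (hk : k ≠ 0) (he : e ∉ F) (hab : G.ends e = s(a, b)) :
    Real (insert e F) β := by
  rcases z3 k with h0 | h0 | h0
  · exact absurd h0 hk
  · subst h0; have := h.ins1 he hab; simpa using this
  · subst h0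
    have := h.ins1 he (hab.trans Sym2.eq_swap); rw [dd_swap] at this; simpa using this

/-- triangle trees with a record of interior edges -/
inductive TT (G : Multigraph) : Set G.V → Set G.E → Set G.E → Prop
  | base (x y z : G.V) (e1 e2 e3 : G.E)
      (hxy : x ≠ y) (hxz : x ≠ z) (hyz : y ≠ z)
      (h1 : G.ends e1 = s(x, y)) (h2 : G.ends e2 = s(y, z)) (h3 : G.ends e3 = s(x, z)) :
      TT G {x, y, z} {e1, e2, e3} ∅
  | grow (S : Set G.V) (F I : Set G.E) (hT : TT G S F I)
      (v a b : G.V) (hv : v ∉ S) (e : G.E) (he : e ∈ F) (hab : G.ends e = s(a, b))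
      (e1 e2 : G.E) (h1 : G.ends e1 = s(v, a)) (h2 : G.ends e2 = s(v, b)) :
      TT G (insert v S) (insert e1 (insert e2 F)) (insert e I)

/-- same, starting from an edge -/
inductive ET (G : Multigraph) : Set G.V → Set G.E → Prop
  | base (x y : G.V) (e : G.E) (h : G.ends e = s(x, y)) : ET G {x, y} {e}
  | grow (S : Set G.V) (F : Set G.E) (hT : ET G S F)
      (v a b : G.V) (hv : v ∉ S) (e : G.E) (he : e ∈ F) (hab : G.ends e = s(a, b))
      (e1 e2 : G.E) (h1 : G.ends e1 = s(v, a)) (h2 : G.ends e2 = s(v, b)) :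
      ET G (insert v S) (insert e1 (insert e2 F))

lemma exists_TT {S : Set G.V} {F : Set G.E} (h : G.IsTriangleTree S F) : ∃ I, TT G S F I := by
  induction h with
  | base x y z e1 e2 e3 hxy hxz hyz h1 h2 h3 => exact ⟨_, .base x y z e1 e2 e3 hxy hxz hyz h1 h2 h3⟩
  | grow S F hT v a b hv e he hab e1 e2 h1 h2 ih =>
    obtain ⟨I, hI⟩ := ih
    exact ⟨_, .grow S F I hI v a b hv e he hab e1 e2 h1 h2⟩

lemma ne_of_ends {e : G.E} {a b : G.V} (h : G.ends e = s(a, b)) : a ≠ b := by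
  intro hab
  apply G.loopless e
  rw [h, hab]; simp

lemma TT.toET {S : Set G.V} {F I : Set G.E} (h : TT G S F I) : ET G S F := by
  induction h with
  | base x y z e1 e2 e3 hxy hxz hyz h1 h2 h3 =>
    have h := ET.grow _ _ (ET.base y z e2 h2) x y z (by simp [hxy, hxz]) e2 (by simp) h2 e1 e3 h1 h3
    have h' : ({e1, e2, e3} : Set G.E) = insert e1 (insert e3 {e2}) := by
      ext f; simp; tauto
    rw [h']; exact h
  | grow S F I hT v a b hv e he hab e1 e2 h1 h2 ih => exact .grow S F ih v a b hv e he hab e1 e2 h1 h2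

lemma ET.sub {S : Set G.V} {F : Set G.E} (h : ET G S F) : ∀ e ∈ F, ∀ v ∈ G.ends e, v ∈ S := by
  induction h with
  | base x y e h => intro f hf v hv; simp at hf; subst hf; rw [h] at hv; simpa using hv
  | grow S F hT v a b hv e he hab e1 e2 h1 h2 ih =>
    have ha := ih e he a (by simp [hab])
    have hb := ih e he b (by simp [hab])
    intro f hf w hw
    rcases hf with rfl | rfl | hf
    · rw [h1] at hw; simp at hw; rcases hw with rfl | rfl <;> simp [*]
    · rw [h2] at hw; simp at hw; rcases hw with rfl | rfl <;> simp [*]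
    · exact Or.inr (ih f hf w hw)

lemma two_nz : ∀ c : ZMod 3, ∃ k l : ZMod 3, k ≠ 0 ∧ l ≠ 0 ∧ k + l = c := by decide

/-- weak realizability: one edge is free -/
def Wk (S : Set G.V) (F : Set G.E) : Prop :=
  ∀ f ∈ F, ∀ a b : G.V, G.ends f = s(a, b) → ∀ β, Bd S β → ∃ k : ZMod 3, Real (F \ {f}) (β - k • dd a b)

lemma bd_pair {x y : G.V} (hxy : x ≠ y) {β : G.V → ZMod 3} (h : Bd {x, y} β) : β = β x • dd x y := by
  have h2 := h.2
  rw [← Finset.sum_subset (Finset.subset_univ {x, y}) (by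
    intro v _ hv; exact h.1 v (by simpa using hv)), Finset.sum_pair hxy] at h2
  funext v
  by_cases hx : v = x
  · subst hx; simp [dd, hxy]
  by_cases hy : v = y
  · subst hy; simp [dd, hxy.symm]; linear_combination h2
  · simp [dd, hx, hy]; exact h.1 v (by simp [hx, hy])

lemma new_ne {e1 e2 : G.E} {v a b : G.V} (hab : a ≠ b)
    (h1 : G.ends e1 = s(v, a)) (h2 : G.ends e2 = s(v, b)) : e1 ≠ e2 := by
  rintro rfl
  rw [h1] at h2
  have := Sym2.congr_right.1 h2
  exact hab this

lemma new_notin {S : Set G.V} {F : Set G.E} (hs : ∀ e ∈ F, ∀ v ∈ G.ends e, v ∈ S) {v a : G.V}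
    (hv : v ∉ S) {e1 : G.E} (h1 : G.ends e1 = s(v, a)) : e1 ∉ F :=
  fun h => hv (hs e1 h v (by simp [h1]))

/-- adding a vertex through two nonzero edges -/
lemma Real.two {F : Set G.E} {β : G.V → ZMod 3} {v a b : G.V} {e1 e2 : G.E} {k l : ZMod 3}
    (hR : Real F (β - k • dd v a - l • dd v b)) (hk : k ≠ 0) (hl : l ≠ 0)
    (h1 : G.ends e1 = s(v, a)) (h2 : G.ends e2 = s(v, b)) (hne : e1 ≠ e2)
    (n1 : e1 ∉ F) (n2 : e2 ∉ F) : Real (insert e1 (insert e2 F)) β :=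
  Real.ins (k := k) (Real.ins (k := l) hR hl n2 h2) hk (by simp [hne, n1]) h1

lemma dd_tri (v a b : G.V) : dd v a = dd v b - dd a b := by simp [dd]

lemma wk_swap {F : Set G.E} {f : G.E} {β : G.V → ZMod 3} {a b : G.V}
    (h : ∃ k : ZMod 3, Real (F \ {f}) (β - k • dd a b)) :
    ∃ k : ZMod 3, Real (F \ {f}) (β - k • dd b a) := by
  obtain ⟨k, hk⟩ := h
  exact ⟨-k, by rw [dd_swap a b]; simpa using hk⟩

/-- the step for `Wk` at one of the new edges -/
lemma wk_core {S : Set G.V} {F : Set G.E} (hs : ∀ e ∈ F, ∀ v ∈ G.ends e, v ∈ S) (ih : Wk S F)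
    {v a b : G.V} (hv : v ∉ S) {e : G.E} (he : e ∈ F) (hab : G.ends e = s(a, b))
    {e2 : G.E} (h2 : G.ends e2 = s(v, b))
    {β : G.V → ZMod 3} (hβ : Bd (insert v S) β) :
    ∃ t : ZMod 3, t ≠ 0 ∧ Real (insert e2 F) (β - (β v - t) • dd v a) := by
  have ha := hs e he a (by simp [hab])
  have hb := hs e he b (by simp [hab])
  have n2 := new_notin hs hv h2
  obtain ⟨k, hk⟩ := ih e he a b hab _ (hβ.peel hv ha hb (β v) 0 (by simp))
  have key : ∀ k : ZMod 3, ∃ t : ZMod 3, t ≠ 0 ∧ k - t ≠ 0 := by decide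
  obtain ⟨t, ht, hkt⟩ := key k
  refine ⟨t, ht, ?_⟩
  refine Real.ins (k := t) ?_ ht n2 h2
  have hFe : F = insert e (F \ {e}) := by simp [Set.insert_eq_of_mem he]
  rw [hFe]
  refine Real.ins (k := k - t) ?_ hkt (by simp) hab
  convert hk using 1
  rw [dd_tri v a b]
  module

lemma diff_new {F : Set G.E} {e1 e2 : G.E} (hne : e1 ≠ e2) (n1 : e1 ∉ F) :
    insert e1 (insert e2 F) \ {e1} = insert e2 F := by
  ext f; simp only [Set.mem_sdiff, Set.mem_insert_iff, Set.mem_singleton_iff]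
  constructor
  · tauto
  · intro h; refine ⟨Or.inr h, ?_⟩; rintro rfl; rcases h with h | h
    · exact hne h
    · exact n1 h

lemma wk_new {S : Set G.V} {F : Set G.E} (hs : ∀ e ∈ F, ∀ v ∈ G.ends e, v ∈ S) (ih : Wk S F)
    {v a b : G.V} (hv : v ∉ S) {e : G.E} (he : e ∈ F) (hab : G.ends e = s(a, b))
    {e1 e2 : G.E} (h1 : G.ends e1 = s(v, a)) (h2 : G.ends e2 = s(v, b))
    {β : G.V → ZMod 3} (hβ : Bd (insert v S) β) {p q : G.V} (hpq : G.ends e1 = s(p, q)) :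
    ∃ k : ZMod 3, Real (insert e1 (insert e2 F) \ {e1}) (β - k • dd p q) := by
  have main : ∃ k : ZMod 3, Real (insert e1 (insert e2 F) \ {e1}) (β - k • dd v a) := by
    rw [diff_new (new_ne (ne_of_ends hab) h1 h2) (new_notin hs hv h1)]
    obtain ⟨t, _, ht⟩ := wk_core hs ih hv he hab h2 hβ
    exact ⟨_, ht⟩
  rw [h1, Sym2.eq_iff] at hpq
  rcases hpq with ⟨rfl, rfl⟩ | ⟨rfl, rfl⟩
  · exact main
  · exact wk_swap main

lemma through {S : Set G.V} {F : Set G.E} (hs : ∀ e ∈ F, ∀ v ∈ G.ends e, v ∈ S) (ih : Wk S F)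
    {v a b : G.V} (hv : v ∉ S) {e : G.E} (he : e ∈ F) (hab : G.ends e = s(a, b))
    {e1 e2 : G.E} (h1 : G.ends e1 = s(v, a)) (h2 : G.ends e2 = s(v, b))
    {β : G.V → ZMod 3} (hβ : Bd (insert v S) β) (h0 : β v = 0) :
    Real (insert e1 (insert e2 F)) β := by
  obtain ⟨t, ht, hR⟩ := wk_core hs ih hv he hab h2 hβ
  refine hR.ins (by simpa [h0] using ht) ?_ h1
  simp [new_ne (ne_of_ends hab) h1 h2, new_notin hs hv h1]

lemma ET.wk {S : Set G.V} {F : Set G.E} (h : ET G S F) : Wk S F := by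
  induction h with
  | base x y e h =>
    intro f hf a b hab β hβ
    simp at hf; subst hf
    have hβ' : Bd {a, b} β := by
      rw [h, Sym2.eq_iff] at hab
      rcases hab with ⟨rfl, rfl⟩ | ⟨rfl, rfl⟩
      · exact hβ
      · rwa [Set.pair_comm]
    refine ⟨β a, ?_⟩
    have h2 := bd_pair (ne_of_ends hab) hβ'
    rw [sub_eq_zero.2 h2]
    simpa using real_empty
  | grow S F hT v a b hv e he hab e1 e2 h1 h2 ih =>
    have hs := hT.sub
    have ha := hs e he a (by simp [hab])
    have hb := hs e he b (by simp [hab])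
    have n1 := new_notin hs hv h1
    have n2 := new_notin hs hv h2
    intro f hf p q hpq β hβ
    rcases hf with rfl | rfl | hf
    · exact wk_new hs ih hv he hab h1 h2 hβ hpq
    · rw [Set.insert_comm]
      exact wk_new hs ih hv he (hab.trans Sym2.eq_swap) h2 h1 hβ hpq
    · obtain ⟨k, l, hk, hl, hkl⟩ := two_nz (β v)
      obtain ⟨m, hm⟩ := ih f hf p q hpq _ (hβ.peel hv ha hb k l hkl)
      refine ⟨m, ?_⟩
      have hF : insert e1 (insert e2 F) \ {f} = insert e1 (insert e2 (F \ {f})) := by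
        have g1 : e1 ≠ f := fun h => n1 (h ▸ hf)
        have g2 : e2 ≠ f := fun h => n2 (h ▸ hf)
        rw [Set.insert_sdiff_of_notMem _ (by simpa using g1), Set.insert_sdiff_of_notMem _ (by simpa using g2)]
      rw [hF]
      refine Real.two (k := k) (l := l) ?_ hk hl h1 h2 (new_ne (ne_of_ends hab) h1 h2)
        (fun h => n1 h.1) (fun h => n2 h.1)
      convert hm using 1
      module

/-- proper colourings -/
def Pc (c : G.V → ZMod 3) (F : Set G.E) : Prop :=
  ∀ f ∈ F, ∀ a b, G.ends f = s(a, b) → c a ≠ c b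

lemma pair_dd (c : G.V → ZMod 3) (a b : G.V) : ∑ w, c w * dd a b w = c a - c b := by
  simp [dd, mul_sub, Finset.sum_sub_distrib, Pi.single_apply]

lemma sum_three : ∀ x y z : ZMod 3, x ≠ y → x ≠ z → y ≠ z → x + y + z = 0 := by decide

lemma ET.col {S : Set G.V} {F : Set G.E} (h : ET G S F) (c : G.V → ZMod 3) (hc : Pc c F) :
    ∀ β, Bd S β → ∑ w, c w * β w ≠ 0 → Real F β := by
  induction h with
  | base x y e h =>
    intro β hβ h0
    have h2 := bd_pair (ne_of_ends h) hβ
    have hx : β x ≠ 0 := by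
      intro hx
      rw [hx, zero_smul] at h2
      subst h2; simp at h0
    have : Real (insert e ∅) β := by
      refine Real.ins (k := β x) ?_ hx (by simp) h
      rw [← h2, sub_self]; exact real_empty
    simpa using this
  | grow S F hT v a b hv e he hab e1 e2 h1 h2 ih =>
    intro β hβ h0
    have hs := hT.sub
    have ha := hs e he a (by simp [hab])
    have hb := hs e he b (by simp [hab])
    by_cases hz : β v = 0
    · exact through hs hT.wk hv he hab h1 h2 hβ hz
    · have hc3 := sum_three _ _ _ (hc e1 (by simp) _ _ h1) (hc e2 (by simp) _ _ h2)
        (hc e (by simp [he]) _ _ hab)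
      have three : (3 : ZMod 3) = 0 := by decide
      refine Real.two (k := - β v) (l := - β v) ?_ (by simpa using hz) (by simpa using hz) h1 h2
        (new_ne (ne_of_ends hab) h1 h2) (new_notin hs hv h1) (new_notin hs hv h2)
      refine ih (fun f hf => hc f (by simp [hf])) _
        (hβ.peel hv ha hb _ _ (by linear_combination (- β v) * three)) ?_
      have : ∑ w, c w * (β - (-β v) • dd v a - (-β v) • dd v b) w = ∑ w, c w * β w := by
        have e : ∀ w, c w * (β - (-β v) • dd v a - (-β v) • dd v b) w =
          c w * β w + β v * (c w * dd v a w) + β v * (c w * dd v b w) := by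
          intro w; simp; ring
        simp only [e, Finset.sum_add_distrib, ← Finset.mul_sum, pair_dd]
        linear_combination (-β v) * hc3 + β v * c v * three
      rw [this]; exact h0

lemma ET.exists_col {S : Set G.V} {F : Set G.E} (h : ET G S F) : ∃ c, Pc c F := by
  induction h with
  | base x y e h =>
    refine ⟨Pi.single x 1, ?_⟩
    intro f hf a b hab
    simp at hf; subst hf
    have hxy := ne_of_ends h
    rw [h, Sym2.eq_iff] at hab
    rcases hab with ⟨rfl, rfl⟩ | ⟨rfl, rfl⟩ <;> simp [hxy.symm]
  | grow S F hT v a b hv e he hab e1 e2 h1 h2 ih =>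
    obtain ⟨c, hc⟩ := ih
    have hs := hT.sub
    have key : ∀ x y : ZMod 3, ∃ z, z ≠ x ∧ z ≠ y := by decide
    obtain ⟨z, hz1, hz2⟩ := key (c a) (c b)
    have hva := ne_of_ends h1
    have hvb := ne_of_ends h2
    refine ⟨Function.update c v z, ?_⟩
    intro f hf p q hpq
    rcases hf with rfl | rfl | hf
    · rw [h1, Sym2.eq_iff] at hpq
      rcases hpq with ⟨rfl, rfl⟩ | ⟨rfl, rfl⟩
      · simpa [hva.symm] using hz1
      · simpa [hva.symm] using hz1.symm
    · rw [h2, Sym2.eq_iff] at hpq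
      rcases hpq with ⟨rfl, rfl⟩ | ⟨rfl, rfl⟩
      · simpa [hvb.symm] using hz2
      · simpa [hvb.symm] using hz2.symm
    · have hp : p ≠ v := fun h => hv (h ▸ hs f hf p (by simp [hpq]))
      have hq : q ≠ v := fun h => hv (h ▸ hs f hf q (by simp [hpq]))
      simpa [hp, hq] using hc f hf p q hpq

lemma ET.zc_ins {S : Set G.V} {F : Set G.E} (h : ET G S F) {c : G.V → ZMod 3} (hc : Pc c F)
    {f : G.E} (hf : f ∉ F) {p q : G.V} (hp : p ∈ S) (hq : q ∈ S) (hpq : G.ends f = s(p, q))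
    (hne : c p ≠ c q) : ZC S (insert f F) := by
  intro β hβ
  have key : ∀ x y : ZMod 3, y ≠ 0 → ∃ k : ZMod 3, k ≠ 0 ∧ x - k * y ≠ 0 := by decide
  obtain ⟨k, hk, hk'⟩ := key (∑ w, c w * β w) (c p - c q) (sub_ne_zero.2 hne)
  refine Real.ins (k := k) (h.col c hc _ (hβ.sub ((bd_dd hp hq).smul k)) ?_) hk hf hpq
  have e : ∀ w, c w * (β - k • dd p q) w = c w * β w - k * (c w * dd p q w) := by
    intro w; simp; ring
  simpa only [e, Finset.sum_sub_distrib, ← Finset.mul_sum, pair_dd] using hk'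

lemma TT.sub {S : Set G.V} {F I : Set G.E} (h : TT G S F I) : ∀ e ∈ F, ∀ v ∈ G.ends e, v ∈ S :=
  h.toET.sub

lemma TT.I_sub {S : Set G.V} {F I : Set G.E} (h : TT G S F I) : I ⊆ F := by
  induction h with
  | base x y z e1 e2 e3 hxy hxz hyz h1 h2 h3 => simp
  | grow S F I hT v a b hv e he hab e1 e2 h1 h2 ih =>
    intro f hf
    rcases hf with rfl | hf
    · simp [he]
    · simp [ih hf]

/-- `w` is on an interior edge -/
def On (I : Set G.E) (w : G.V) : Prop := ∃ f ∈ I, w ∈ G.ends f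

lemma tri_norm {S : Set G.V} {F I : Set G.E} (h : TT G S F I) (hI : I = ∅) {x : G.V} (hx : x ∈ S) :
    ∃ y z f g h, x ≠ y ∧ x ≠ z ∧ y ≠ z ∧ S = {x, y, z} ∧ F = {f, g, h} ∧
      G.ends f = s(x, y) ∧ G.ends g = s(y, z) ∧ G.ends h = s(x, z) := by
  cases h with
  | base x y z e1 e2 e3 hxy hxz hyz h1 h2 h3 =>
    rcases hx with rfl | rfl | rfl
    · exact ⟨y, z, e1, e2, e3, hxy, hxz, hyz, rfl, rfl, h1, h2, h3⟩
    · refine ⟨x, z, e1, e3, e2, hxy.symm, hyz, hxz, ?_, ?_, h1.trans Sym2.eq_swap, h3, h2⟩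
      · ext w; simp; tauto
      · ext w; simp; tauto
    · refine ⟨x, y, e3, e1, e2, hxz.symm, hyz.symm, hxy, ?_, ?_, h3.trans Sym2.eq_swap, h1,
        h2.trans Sym2.eq_swap⟩
      · ext w; simp; tauto
      · ext w; simp; tauto
  | grow S F I hT v a b hv e he hab e1 e2 h1 h2 => exact absurd hI (Set.insert_nonempty _ _).ne_empty

lemma tri_edge {S : Set G.V} {F I : Set G.E} (h : TT G S F I) (hI : I = ∅) {e : G.E} (he : e ∈ F)
    {a b : G.V} (hab : G.ends e = s(a, b)) :
    ∃ x f h, x ≠ a ∧ x ≠ b ∧ S = {x, a, b} ∧ f ∈ F ∧ h ∈ F ∧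
      G.ends f = s(x, a) ∧ G.ends h = s(x, b) := by
  have hne := ne_of_ends hab
  have ha := h.sub e he a (by simp [hab])
  obtain ⟨y, z, f, g, k, hxy, hxz, hyz, rfl, rfl, hf, hg, hk⟩ := tri_norm h hI ha
  have hb := h.sub e he b (by simp [hab])
  rcases hb with rfl | rfl | rfl
  · exact absurd rfl hne
  · refine ⟨z, k, g, hxz.symm, hyz.symm, ?_, by simp, by simp, hk.trans Sym2.eq_swap,
      hg.trans Sym2.eq_swap⟩
    ext w; simp; tauto
  · refine ⟨y, f, g, hxy.symm, hyz, ?_, by simp, by simp, hf.trans Sym2.eq_swap, hg⟩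
    ext w; simp; tauto

lemma TT.card {S : Set G.V} {F I : Set G.E} (h : TT G S F I) :
    (I = ∅ → S.ncard = 3) ∧ (I ≠ ∅ → 4 ≤ S.ncard) := by
  induction h with
  | base x y z e1 e2 e3 hxy hxz hyz h1 h2 h3 =>
    refine ⟨fun _ => ?_, fun h => absurd rfl h⟩
    rw [Set.ncard_insert_of_notMem (by simp [hxy, hxz]), Set.ncard_pair hyz]
  | grow S F I hT v a b hv e he hab e1 e2 h1 h2 ih =>
    refine ⟨fun h => absurd h (Set.insert_nonempty _ _).ne_empty, fun _ => ?_⟩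
    rw [Set.ncard_insert_of_notMem hv]
    by_cases hI : I = ∅
    · have := ih.1 hI; omega
    · have := ih.2 hI; omega

lemma TT.leaf_real {S : Set G.V} {F I : Set G.E} (h : TT G S F I) :
    ∀ x ∈ S, ¬ On I x → ∀ β, Bd S β → β x = 0 → Real F β := by
  induction h with
  | base x y z e1 e2 e3 hxy hxz hyz h1 h2 h3 =>
    intro p hp _ β hβ h0
    obtain ⟨y', z', f, g, k, hxy', hxz', hyz', hS, hF, hf, hg, hk⟩ :=
      tri_norm (TT.base x y z e1 e2 e3 hxy hxz hyz h1 h2 h3) rfl hp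
    have hE := ET.base y' z' g hg
    have := through hE.sub hE.wk (v := p) (by simp [hxy', hxz']) (e := g) (by simp) hg hf hk
      (by rwa [← hS]) h0
    rw [hF]
    convert this using 1
    ext w; simp; tauto
  | grow S F I hT v a b hv e he hab e1 e2 h1 h2 ih =>
    intro x hx hO β hβ h0
    have hs := hT.sub
    have ha := hs e he a (by simp [hab])
    have hb := hs e he b (by simp [hab])
    rcases hx with rfl | hx
    · exact through hs hT.toET.wk hv he hab h1 h2 hβ h0
    · have hxa : x ≠ a := fun h => hO ⟨e, by simp, by simp [hab, h]⟩
      have hxb : x ≠ b := fun h => hO ⟨e, by simp, by simp [hab, h]⟩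
      have hxv : x ≠ v := fun h => hv (h ▸ hx)
      obtain ⟨k, l, hk, hl, hkl⟩ := two_nz (β v)
      refine Real.two (k := k) (l := l) ?_ hk hl h1 h2
        (new_ne (ne_of_ends hab) h1 h2) (new_notin hs hv h1) (new_notin hs hv h2)
      refine ih x hx (fun ⟨f, hf, hf'⟩ => hO ⟨f, by simp [hf], hf'⟩) _ (hβ.peel hv ha hb k l hkl) ?_
      simp [dd, h0, hxa, hxb, hxv]

lemma TT.zc_two {S : Set G.V} {F I : Set G.E} (h : TT G S F I) {x y z : G.V} (hx : x ∈ S)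
    (hl : ¬ On I x) (hy : y ∈ S) (hz : z ∈ S) {f g : G.E} (hf : f ∉ F) (hg : g ∉ F) (hfg : f ≠ g)
    (hfe : G.ends f = s(x, y)) (hge : G.ends g = s(x, z)) : ZC S (insert f (insert g F)) := by
  intro β hβ
  obtain ⟨k, l, hk, hl', hkl⟩ := two_nz (β x)
  refine Real.two (k := k) (l := l) ?_ hk hl' hfe hge hfg hf hg
  refine h.leaf_real x hx hl _ ((hβ.sub ((bd_dd hx hy).smul k)).sub ((bd_dd hx hz).smul l)) ?_
  have nxy := ne_of_ends hfe
  have nxz := ne_of_ends hge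
  simp only [dd, Pi.sub_apply, Pi.smul_apply, Pi.single_eq_same, Pi.single_eq_of_ne nxy,
    Pi.single_eq_of_ne nxz, smul_eq_mul]
  linear_combination -hkl

lemma set_or {D : G.E → G.V × G.V} (hD : G.IsOrientation D) {e : G.E} {a b : G.V}
    (h : G.ends e = s(a, b)) : ∃ D', G.IsOrientation D' ∧ D' e = (a, b) ∧ ∀ f, f ≠ e → D' f = D f := by
  refine ⟨Function.update D e (a, b), ?_, by simp, fun f hf => by simp [hf]⟩
  intro f
  by_cases hf : f = e
  · subst hf; simpa using h
  · simpa [hf] using hD f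

lemma so_sub {S : Set G.V} {K K' : Set G.E} {D : G.E → G.V × G.V} (hD : G.IsOrientation D)
    (hS : ∀ u ∈ S, ∀ v ∈ S, Relation.ReflTransGen (fun p q => ∃ e ∈ K, D e = (p, q)) u v)
    {v a b : G.V} (ha : a ∈ S) (hb : b ∈ S) {e1 e2 : G.E} (h1 : G.ends e1 = s(v, a))
    (h2 : G.ends e2 = s(v, b)) (hne : e1 ≠ e2) (n1 : e1 ∉ K) (n2 : e2 ∉ K) (m1 : e1 ∈ K')
    (m2 : e2 ∈ K') (hK : ∀ f ∈ K, f ∈ K' ∨ D f = (a, b)) : SO (insert v S) K' := by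
  obtain ⟨D1, hD1, he1, hf1⟩ := set_or hD (h1.trans Sym2.eq_swap)
  obtain ⟨D2, hD2, he2, hf2⟩ := set_or hD1 h2
  have hD2e1 : D2 e1 = (a, v) := by rw [hf2 _ hne, he1]
  refine ⟨D2, hD2, ?_⟩
  have av : Relation.ReflTransGen (fun p q => ∃ e ∈ K', D2 e = (p, q)) a v := .single ⟨e1, m1, hD2e1⟩
  have vb : Relation.ReflTransGen (fun p q => ∃ e ∈ K', D2 e = (p, q)) v b := .single ⟨e2, m2, he2⟩
  have lift : ∀ p q, Relation.ReflTransGen (fun p q => ∃ e ∈ K, D e = (p, q)) p q →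
      Relation.ReflTransGen (fun p q => ∃ e ∈ K', D2 e = (p, q)) p q := by
    intro p q h
    induction h with
    | refl => exact .refl
    | tail _ hs ih =>
      refine ih.trans ?_
      obtain ⟨f, hf, hfe⟩ := hs
      rcases hK f hf with h | h
      · refine .single ⟨f, h, ?_⟩
        rw [hf2 f (fun h => n2 (h ▸ hf)), hf1 f (fun h => n1 (h ▸ hf)), hfe]
      · rw [hfe] at h
        obtain ⟨rfl, rfl⟩ := Prod.mk.inj h
        exact av.trans vb
  intro p hp q hq
  rcases hp with rfl | hp <;> rcases hq with rfl | hq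
  · exact .refl
  · exact vb.trans (lift _ _ (hS _ hb _ hq))
  · exact (lift _ _ (hS _ hp _ ha)).trans av
  · exact lift _ _ (hS _ hp _ hq)

lemma so_ear {S : Set G.V} {K : Set G.E} (h : SO S K)
    {v a b : G.V} (ha : a ∈ S) (hb : b ∈ S) {e1 e2 : G.E} (h1 : G.ends e1 = s(v, a))
    (h2 : G.ends e2 = s(v, b)) (hne : e1 ≠ e2) (n1 : e1 ∉ K) (n2 : e2 ∉ K) :
    SO (insert v S) (insert e1 (insert e2 K)) := by
  obtain ⟨D, hD, hS⟩ := h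
  exact so_sub hD hS ha hb h1 h2 hne n1 n2 (by simp) (by simp) (fun f hf => Or.inl (by simp [hf]))

lemma so_of_hub {S : Set G.V} {K : Set G.E} {D : G.E → G.V × G.V} (hD : G.IsOrientation D) (a : G.V)
    (h : ∀ u ∈ S, Relation.ReflTransGen (fun p q => ∃ e ∈ K, D e = (p, q)) a u ∧
      Relation.ReflTransGen (fun p q => ∃ e ∈ K, D e = (p, q)) u a) : SO S K :=
  ⟨D, hD, fun u hu v hv => (h u hu).2.trans (h v hv).1⟩

lemma TT.so {S : Set G.V} {F I : Set G.E} (h : TT G S F I) : ∀ X ⊆ I, SO S (F \ X) := by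
  induction h with
  | base x y z e1 e2 e3 hxy hxz hyz h1 h2 h3 =>
    intro X hX
    obtain rfl := Set.subset_empty_iff.1 hX
    simp only [Set.sdiff_empty]
    have h12 : e1 ≠ e2 := new_ne hxz (h1.trans Sym2.eq_swap) h2
    have h13 : e1 ≠ e3 := new_ne hyz h1 h3
    have h23 : e2 ≠ e3 := new_ne hxy.symm (h2.trans Sym2.eq_swap) (h3.trans Sym2.eq_swap)
    obtain ⟨D0, hD0⟩ := exists_or (G := G)
    obtain ⟨D1, hD1, k1, l1⟩ := set_or hD0 h1
    obtain ⟨D2, hD2, k2, l2⟩ := set_or hD1 h2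
    obtain ⟨D3, hD3, k3, l3⟩ := set_or hD2 (h3.trans Sym2.eq_swap)
    have r1 : ∃ e ∈ ({e1, e2, e3} : Set G.E), D3 e = (x, y) :=
      ⟨e1, by simp, by rw [l3 _ h13, l2 _ h12, k1]⟩
    have r2 : ∃ e ∈ ({e1, e2, e3} : Set G.E), D3 e = (y, z) :=
      ⟨e2, by simp, by rw [l3 _ h23, k2]⟩
    have r3 : ∃ e ∈ ({e1, e2, e3} : Set G.E), D3 e = (z, x) := ⟨e3, by simp, k3⟩
    refine so_of_hub hD3 x ?_
    intro u hu
    rcases hu with rfl | rfl | rfl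
    · exact ⟨.refl, .refl⟩
    · exact ⟨.single r1, .tail (.single r2) r3⟩
    · exact ⟨.tail (.single r1) r2, .single r3⟩
  | grow S F I hT v a b hv e he hab e1 e2 h1 h2 ih =>
    intro X hX
    have hs := hT.sub
    have ha := hs e he a (by simp [hab])
    have hb := hs e he b (by simp [hab])
    have n1 := new_notin hs hv h1
    have n2 := new_notin hs hv h2
    have hne := new_ne (ne_of_ends hab) h1 h2
    have hXF : X ⊆ F := fun f hf => by
      rcases hX hf with rfl | h
      · exact he
      · exact hT.I_sub h
    obtain ⟨D, hD, hS⟩ := ih (X \ {e}) (by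
      rintro f ⟨hf, hfe⟩
      rcases hX hf with h | h
      · exact absurd h hfe
      · exact h)
    have m1 : e1 ∈ insert e1 (insert e2 F) \ X := ⟨by simp, fun h => n1 (hXF h)⟩
    have m2 : e2 ∈ insert e1 (insert e2 F) \ X := ⟨by simp, fun h => n2 (hXF h)⟩
    have hK : ∀ f ∈ F \ (X \ {e}), f ∈ insert e1 (insert e2 F) \ X ∨ f = e := by
      rintro f ⟨hf, hfX⟩
      by_cases hfe : f = e
      · exact Or.inr hfe
      · exact Or.inl ⟨by simp [hf], fun h => hfX ⟨h, hfe⟩⟩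
    have hor := hD e
    rw [hab, Sym2.eq_iff] at hor
    rcases hor with ⟨q1, q2⟩ | ⟨q1, q2⟩
    · refine so_sub hD hS ha hb h1 h2 hne (fun h => n1 h.1) (fun h => n2 h.1) m1 m2 (fun f hf => ?_)
      rcases hK f hf with h | rfl
      · exact Or.inl h
      · right; rw [q1, q2]
    · refine so_sub hD hS hb ha h2 h1 hne.symm (fun h => n2 h.1) (fun h => n1 h.1) m2 m1
        (fun f hf => ?_)
      rcases hK f hf with h | rfl
      · exact Or.inl h
      · right; rw [q1, q2]

lemma TT.touch {S : Set G.V} {F I : Set G.E} (h : TT G S F I) :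
    I ≠ ∅ → ∀ f ∈ F, ∃ w ∈ G.ends f, On I w := by
  induction h with
  | base x y z e1 e2 e3 hxy hxz hyz h1 h2 h3 => intro h; exact absurd rfl h
  | grow S F I hT v a b hv e he hab e1 e2 h1 h2 ih =>
    intro _ f hf
    rcases hf with rfl | rfl | hf
    · exact ⟨a, by simp [h1], e, by simp, by simp [hab]⟩
    · exact ⟨b, by simp [h2], e, by simp, by simp [hab]⟩
    · by_cases hI : I = ∅
      · obtain ⟨x, f', k, hxa, hxb, hS, -, -, -, -⟩ := tri_edge hT hI he hab
        have hw : ∃ w ∈ G.ends f, w ≠ x := by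
          obtain ⟨D, hD⟩ := exists_or (G := G)
          have := ne_of_ends (hD f)
          by_cases hx : (D f).1 = x
          · exact ⟨(D f).2, by rw [hD f]; simp, fun h => this (hx.trans h.symm)⟩
          · exact ⟨(D f).1, by rw [hD f]; simp, hx⟩
        obtain ⟨w, hw, hwx⟩ := hw
        have := hT.sub f hf w hw
        rw [hS] at this
        refine ⟨w, hw, e, by simp, ?_⟩
        rw [hab]
        simpa [hwx] using this
      · obtain ⟨w, hw, g, hg, hwg⟩ := ih hI f hf
        exact ⟨w, hw, g, by simp [hg], hwg⟩

lemma TT.const {S : Set G.V} {F I : Set G.E} (h : TT G S F I) {α : Type} (g : G.V → α) :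
    (∀ f ∈ I, ∀ a b, G.ends f = s(a, b) → g a = g b) → ∀ p q, On I p → On I q → g p = g q := by
  induction h with
  | base x y z e1 e2 e3 hxy hxz hyz h1 h2 h3 => rintro - p q ⟨f, hf, -⟩; exact absurd hf (by simp)
  | grow S F I hT v a b hv e he hab e1 e2 h1 h2 ih =>
    intro hg
    have hgI := ih (fun f hf => hg f (by simp [hf]))
    have gab := hg e (by simp) a b hab
    have ge : ∀ w ∈ G.ends e, g w = g a := by
      intro w hw
      rw [hab] at hw; simp at hw
      rcases hw with rfl | rfl
      · rfl
      · exact gab.symm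
    have : ∀ p, On (insert e I) p → g p = g a := by
      rintro p ⟨f, rfl | hf, hpf⟩
      · exact ge p hpf
      · obtain ⟨w, hw, hwI⟩ := hT.touch (Set.nonempty_iff_ne_empty.1 ⟨f, hf⟩) e he
        rw [hgI p w ⟨f, hf, hpf⟩ hwI, ge w hw]
    intro p q hp hq
    rw [this p hp, this q hq]

lemma TT.last {S : Set G.V} {F I : Set G.E} (h : TT G S F I) (hI : I ≠ ∅) :
    ∃ x ∈ S, ¬ On I x ∧ ∃ e ∈ I, ∃ u v, G.ends e = s(u, v) ∧ ∃ e1 ∈ F, ∃ e2 ∈ F,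
      G.ends e1 = s(x, u) ∧ G.ends e2 = s(x, v) := by
  cases h with
  | base x y z e1 e2 e3 hxy hxz hyz h1 h2 h3 => exact absurd rfl hI
  | grow S F I hT v a b hv e he hab e1 e2 h1 h2 =>
    refine ⟨v, by simp, ?_, e, by simp, a, b, hab, e1, by simp, e2, by simp, h1, h2⟩
    rintro ⟨f, rfl | hf, hvf⟩
    · exact hv (hT.sub f he v hvf)
    · exact hv (hT.sub f (hT.I_sub hf) v hvf)

lemma TT.remove {S : Set G.V} {F I : Set G.E} (h : TT G S F I) :
    I ≠ ∅ → ∀ x ∈ S, ¬ On I x → ∃ F0 I0, TT G (S \ {x}) F0 I0 ∧ F0 ⊆ F ∧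
      (∀ f ∈ F, x ∉ G.ends f → f ∈ F0) ∧
      ∃ f1 ∈ F, ∃ f2 ∈ F, ∃ a ∈ S \ {x}, ∃ b ∈ S \ {x}, f1 ≠ f2 ∧
        G.ends f1 = s(x, a) ∧ G.ends f2 = s(x, b) := by
  induction h with
  | base x y z e1 e2 e3 hxy hxz hyz h1 h2 h3 => intro h; exact absurd rfl h
  | grow S F I hT v a b hv e he hab e1 e2 h1 h2 ih =>
    intro _ x hx hO
    have hs := hT.sub
    have ha := hs e he a (by simp [hab])
    have hb := hs e he b (by simp [hab])
    have hne := new_ne (ne_of_ends hab) h1 h2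
    by_cases hxv : x = v
    · subst hxv
      have hS : insert x S \ {x} = S := by simp [hv]
      rw [hS]
      refine ⟨F, I, hT, fun f hf => by simp [hf], ?_, e1, by simp, e2, by simp, a, ha, b, hb, hne, h1, h2⟩
      intro f hf hxf
      rcases hf with rfl | rfl | hf
      · exact absurd (by simp [h1]) hxf
      · exact absurd (by simp [h2]) hxf
      · exact hf
    · have hxS : x ∈ S := by
        rcases hx with h | h
        · exact absurd h hxv
        · exact h
      have hxe : x ∉ G.ends e := fun h => hO ⟨e, by simp, h⟩
      have hSx : insert v S \ {x} = insert v (S \ {x}) :=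
        Set.insert_sdiff_of_notMem _ (by simpa using fun h => hxv h.symm)
      rw [hSx]
      by_cases hI : I = ∅
      · obtain ⟨y, z, f, g, k, hxy, hxz, hyz, rfl, rfl, hf, hg, hk⟩ := tri_norm hT hI hxS
        have heg : e = g := by
          rcases he with rfl | rfl | rfl
          · exact absurd (by simp [hf]) hxe
          · rfl
          · exact absurd (by simp [hk]) hxe
        subst heg
        have hva := ne_of_ends h1
        have hvb := ne_of_ends h2
        have hS2 : ({x, y, z} : Set G.V) \ {x} = {a, b} := by
          have : ({x, y, z} : Set G.V) \ {x} = {y, z} := by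
            ext w; simp
            rintro (rfl | rfl)
            · exact hxy.symm
            · exact hxz.symm
          rw [this]
          rw [hab, Sym2.eq_iff] at hg
          rcases hg with ⟨rfl, rfl⟩ | ⟨rfl, rfl⟩
          · rfl
          · exact Set.pair_comm _ _
        refine ⟨{e1, e, e2}, ∅, ?_, ?_, ?_, f, by simp, k, by simp, y, ?_, z, ?_, ?_, hf, hk⟩
        · rw [hS2]
          exact .base v a b e1 e e2 hva hvb (ne_of_ends hab) h1 hab h2
        · intro w hw; simp at hw ⊢; tauto
        · intro w hw hxw
          rcases hw with rfl | rfl | rfl | rfl | rfl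
          · simp
          · simp
          · exact absurd (by simp [hf]) hxw
          · simp
          · exact absurd (by simp [hk]) hxw
        · simp [hxy.symm]
        · simp [hxz.symm]
        · exact new_ne hyz hf hk
      · obtain ⟨F0, I0, hT0, hF0, hF0', f1, hf1, f2, hf2, p, hp, q, hq, hne', g1, g2⟩ :=
          ih hI x hxS (fun ⟨f, hf, hf'⟩ => hO ⟨f, by simp [hf], hf'⟩)
        refine ⟨insert e1 (insert e2 F0), _, .grow _ F0 I0 hT0 v a b (fun h => hv h.1) e
          (hF0' e he hxe) hab e1 e2 h1 h2, ?_, ?_, f1, by simp [hf1], f2, by simp [hf2],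
          p, Or.inr hp, q, Or.inr hq, hne', g1, g2⟩
        · intro f hf
          rcases hf with rfl | rfl | hf
          · simp
          · simp
          · simp [hF0 hf]
        · intro f hf hxf
          rcases hf with rfl | rfl | hf
          · simp
          · simp
          · simp [hF0' f hf hxf]

def Good (S : Set G.V) (F : Set G.E) : Prop :=
  ∃ H K, H ⊆ F ∧ K ⊆ F ∧ Disjoint H K ∧ ZC S H ∧ SO S K

lemma step_A {S : Set G.V} {F1 I1 F2 I2 : Set G.E} (h1 : TT G S F1 I1) (h2 : TT G S F2 I2)
    (hd : Disjoint F1 F2) {c : G.V → ZMod 3} (hc : Pc c F1) {f : G.E} (hf : f ∈ I2) {p q : G.V}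
    (hpq : G.ends f = s(p, q)) (hne : c p ≠ c q) : Good S (F1 ∪ F2) := by
  have hf2 := h2.I_sub hf
  have hf1 : f ∉ F1 := fun h => Set.disjoint_left.1 hd h hf2
  refine ⟨insert f F1, F2 \ {f}, ?_, ?_, ?_, ?_, ?_⟩
  · intro g hg
    rcases hg with rfl | hg
    · exact Or.inr hf2
    · exact Or.inl hg
  · exact fun g hg => Or.inr hg.1
  · rw [Set.disjoint_left]
    rintro g (rfl | hg) hg'
    · exact hg'.2 rfl
    · exact Set.disjoint_left.1 hd hg hg'.1
  · exact h1.toET.zc_ins hc hf1 (h2.sub f hf2 p (by simp [hpq])) (h2.sub f hf2 q (by simp [hpq])) hpq hne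
  · exact h2.so _ (by simpa using hf)

lemma step_B {S : Set G.V} {F1 I1 F2 I2 : Set G.E} (h1 : TT G S F1 I1) (h2 : TT G S F2 I2)
    (hd : Disjoint F1 F2) {x : G.V} (hx : x ∈ S) (hl : ¬ On I1 x) {f g : G.E} (hf : f ∈ I2)
    (hg : g ∈ I2) (hfg : f ≠ g) (hxf : x ∈ G.ends f) (hxg : x ∈ G.ends g) : Good S (F1 ∪ F2) := by
  have hf2 := h2.I_sub hf
  have hg2 := h2.I_sub hg
  have hf1 : f ∉ F1 := fun h => Set.disjoint_left.1 hd h hf2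
  have hg1 : g ∉ F1 := fun h => Set.disjoint_left.1 hd h hg2
  obtain ⟨y, hy⟩ := hxf
  obtain ⟨z, hz⟩ := hxg
  refine ⟨insert f (insert g F1), F2 \ {f, g}, ?_, ?_, ?_, ?_, ?_⟩
  · intro k hk
    rcases hk with rfl | rfl | hk
    · exact Or.inr hf2
    · exact Or.inr hg2
    · exact Or.inl hk
  · exact fun g hg => Or.inr hg.1
  · rw [Set.disjoint_left]
    rintro k (rfl | rfl | hk) hk'
    · exact hk'.2 (by simp)
    · exact hk'.2 (by simp)
    · exact Set.disjoint_left.1 hd hk hk'.1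
  · exact h1.zc_two hx hl (h2.sub f hf2 y (by simp [hy])) (h2.sub g hg2 z (by simp [hz])) hf1 hg1 hfg hy hz
  · refine h2.so _ ?_
    rintro k (rfl | rfl)
    · exact hf
    · exact hg

lemma step_C {S : Set G.V} {F1 I1 F2 I2 : Set G.E} (h1 : TT G S F1 I1) (h2 : TT G S F2 I2)
    (hd : Disjoint F1 F2) (hI1 : I1 ≠ ∅) (hI2 : I2 ≠ ∅) {x : G.V} (hx : x ∈ S) (hl1 : ¬ On I1 x)
    (hl2 : ¬ On I2 x)
    (ih : ∀ F1 I1 F2 I2, TT G (S \ {x}) F1 I1 → TT G (S \ {x}) F2 I2 → Disjoint F1 F2 →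
      Good (S \ {x}) (F1 ∪ F2)) : Good S (F1 ∪ F2) := by
  obtain ⟨P1, J1, t1, s1, -, f1, hf1, f2, hf2, a, ha, b, hb, hne, e1, e2⟩ := h1.remove hI1 x hx hl1
  obtain ⟨P2, J2, t2, s2, -, g1, hg1, g2, hg2, a', ha', b', hb', hne', e1', e2'⟩ :=
    h2.remove hI2 x hx hl2
  obtain ⟨H, K, hH, hK, hHK, zc, so⟩ := ih P1 J1 P2 J2 t1 t2
    (Set.disjoint_of_subset s1 s2 hd)
  have hx0 : x ∉ S \ {x} := by simp
  have hs : ∀ e ∈ P1 ∪ P2, ∀ v ∈ G.ends e, v ∈ S \ {x} := by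
    rintro e (he | he)
    · exact t1.sub e he
    · exact t2.sub e he
  have n1 := new_notin hs hx0 e1
  have n2 := new_notin hs hx0 e2
  have n1' := new_notin hs hx0 e1'
  have n2' := new_notin hs hx0 e2'
  have hS : insert x (S \ {x}) = S := by simp [Set.insert_eq_of_mem hx]
  have hP : P1 ∪ P2 ⊆ F1 ∪ F2 := Set.union_subset_union s1 s2
  refine ⟨insert f1 (insert f2 H), insert g1 (insert g2 K), ?_, ?_, ?_, ?_, ?_⟩
  · rintro k (rfl | rfl | hk)
    · exact Or.inl hf1
    · exact Or.inl hf2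
    · exact hP (hH hk)
  · rintro k (rfl | rfl | hk)
    · exact Or.inr hg1
    · exact Or.inr hg2
    · exact hP (hK hk)
  · rw [Set.disjoint_left] at hd hHK ⊢
    rintro k (rfl | rfl | hk) (rfl | rfl | hk')
    · exact hd hf1 hg1
    · exact hd hf1 hg2
    · exact n1 (hK hk')
    · exact hd hf2 hg1
    · exact hd hf2 hg2
    · exact n2 (hK hk')
    · exact n1' (hH hk)
    · exact n2' (hH hk)
    · exact hHK hk hk'
  · intro β hβ
    obtain ⟨k, l, hk, hl, hkl⟩ := two_nz (β x)
    refine Real.two (k := k) (l := l) (zc _ ?_) hk hl e1 e2 hne (fun h => n1 (hH h)) (fun h => n2 (hH h))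
    exact Bd.peel (by rwa [hS]) hx0 ha hb k l hkl
  · have := so_ear so ha' hb' e1' e2' hne' (fun h => n1' (hK h)) (fun h => n2' (hK h))
    rwa [hS] at this

def Ad (F : Set G.E) (a b : G.V) : Prop := ∃ f ∈ F, G.ends f = s(a, b)

lemma Ad.symm {F : Set G.E} {a b : G.V} (h : Ad F a b) : Ad F b a := by
  obtain ⟨f, hf, h⟩ := h
  exact ⟨f, hf, h.trans Sym2.eq_swap⟩

lemma four {S : Set G.V} {F I : Set G.E} (h : TT G S F I) (hS : S.ncard = 4) :
    ∃ p s q r, p ≠ s ∧ p ≠ q ∧ p ≠ r ∧ s ≠ q ∧ s ≠ r ∧ q ≠ r ∧ S = {p, s, q, r} ∧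
      (∃ m ∈ I, G.ends m = s(q, r)) ∧ Ad F q r ∧ Ad F p q ∧ Ad F p r ∧ Ad F s q ∧ Ad F s r := by
  have hc := h.card
  cases h with
  | base x y z e1 e2 e3 hxy hxz hyz h1 h2 h3 => have := hc.1 rfl; omega
  | grow S F I hT v a b hv e he hab e1 e2 h1 h2 =>
    rw [Set.ncard_insert_of_notMem hv] at hS
    have hI : I = ∅ := by
      by_contra hI
      have := hT.card.2 hI; omega
    obtain ⟨x, f, k, hxa, hxb, rfl, hfF, hkF, hf, hk⟩ := tri_edge hT hI he hab
    simp only [Set.mem_insert_iff, Set.mem_singleton_iff, not_or] at hv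
    exact ⟨v, x, a, b, hv.1, hv.2.1, hv.2.2, hxa, hxb, ne_of_ends hab, rfl, ⟨e, by simp, hab⟩,
      ⟨e, by simp [he], hab⟩, ⟨e1, by simp, h1⟩, ⟨e2, by simp, h2⟩, ⟨f, by simp [hfF], hf⟩,
      ⟨k, by simp [hkF], hk⟩⟩

lemma special {F1 F2 : Set G.E} (hd : Disjoint F1 F2) {a b c d : G.V} (hab : a ≠ b) (hac : a ≠ c)
    (had : a ≠ d) (hbc : b ≠ c) (hbd : b ≠ d) (hcd : c ≠ d)
    (a1 : Ad F1 b c) (a2 : Ad F1 a b) (a3 : Ad F1 a c) (a4 : Ad F1 b d) (a5 : Ad F1 c d)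
    (b1 : Ad F2 a d) (b2 : Ad F2 a b) (b3 : Ad F2 a c) (b4 : Ad F2 b d) (b5 : Ad F2 c d) :
    Good {a, b, c, d} (F1 ∪ F2) := by
  obtain ⟨bc1, m1, a1⟩ := a1
  obtain ⟨ab1, m2, a2⟩ := a2
  obtain ⟨ac1, m3, a3⟩ := a3
  obtain ⟨bd1, m4, a4⟩ := a4
  obtain ⟨cd1, m5, a5⟩ := a5
  obtain ⟨ad2, l1, b1⟩ := b1
  obtain ⟨ab2, l2, b2⟩ := b2
  obtain ⟨ac2, l3, b3⟩ := b3
  obtain ⟨bd2, l4, b4⟩ := b4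
  obtain ⟨cd2, l5, b5⟩ := b5
  have D12 : ∀ {e f : G.E}, e ∈ F1 → f ∈ F2 → e ≠ f := by
    rintro e f he hf rfl
    exact Set.disjoint_left.1 hd he hf
  have De : ∀ {e f : G.E}, G.ends e ≠ G.ends f → e ≠ f := by
    rintro e f h rfl
    exact h rfl
  have Dx : ∀ {e f : G.E} {x y z w : G.V}, G.ends e = s(x, y) → G.ends f = s(z, w) →
      s(x, y) ≠ s(z, w) → e ≠ f := by
    intro e f x y z w h1 h2 h3
    exact De (by rw [h1, h2]; exact h3)
  refine ⟨{ac1, ac2, bd1, bd2, ab1, cd1}, {ab2, bc1, cd2, ad2}, ?_, ?_, ?_, ?_, ?_⟩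
  · rintro k (rfl | rfl | rfl | rfl | rfl | rfl) <;> simp [*]
  · rintro k (rfl | rfl | rfl | rfl) <;> simp [*]
  · rw [Set.disjoint_left]
    have q1 : ac1 ≠ bc1 := Dx a3 a1 (by simp [*])
    have q2 : bd1 ≠ bc1 := Dx a4 a1 (by simp [*, hbc.symm, hcd.symm])
    have q3 : ab1 ≠ bc1 := Dx a2 a1 (by simp [*])
    have q4 : cd1 ≠ bc1 := Dx a5 a1 (by simp [*, hbc.symm, hcd.symm, hbd.symm])
    have q5 : ac2 ≠ ab2 := Dx b3 b2 (by simp [*, hbc.symm])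
    have q6 : ac2 ≠ cd2 := Dx b3 b5 (by simp [*])
    have q7 : ac2 ≠ ad2 := Dx b3 b1 (by simp [*])
    have q8 : bd2 ≠ ab2 := Dx b4 b2 (by simp [*, hab.symm, hbd.symm, had.symm])
    have q9 : bd2 ≠ cd2 := Dx b4 b5 (by simp [*])
    have q10 : bd2 ≠ ad2 := Dx b4 b1 (by simp [*, hab.symm])
    rintro k (rfl | rfl | rfl | rfl | rfl | rfl) (h | h | h | h)
    · exact D12 m3 l2 h
    · exact q1 h
    · exact D12 m3 l5 h
    · exact D12 m3 l1 h
    · exact q5 h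
    · exact D12 m1 l3 h.symm
    · exact q6 h
    · exact q7 h
    · exact D12 m4 l2 h
    · exact q2 h
    · exact D12 m4 l5 h
    · exact D12 m4 l1 h
    · exact q8 h
    · exact D12 m1 l4 h.symm
    · exact q9 h
    · exact q10 h
    · exact D12 m2 l2 h
    · exact q3 h
    · exact D12 m2 l5 h
    · exact D12 m2 l1 h
    · exact D12 m5 l2 h
    · exact q4 h
    · exact D12 m5 l5 h
    · exact D12 m5 l1 h
  · intro β hβ
    have hsum : β a + β b + β c + β d = 0 := by
      have h2 := hβ.2
      rw [← Finset.sum_subset (Finset.subset_univ {a, b, c, d}) (by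
        intro v _ hv; exact hβ.1 v (by simpa using hv)), Finset.sum_insert (by simp [*]),
        Finset.sum_insert (by simp [*]), Finset.sum_pair hcd] at h2
      linear_combination h2
    obtain ⟨k1, k2, hk1, hk2, hk⟩ := two_nz (β a + β c)
    obtain ⟨f1, f2, hf1, hf2, hf⟩ := two_nz (β a - k1)
    obtain ⟨g1, g2, hg1, hg2, hg⟩ := two_nz (β b + k1)
    have r1 : ac1 ≠ ac2 := D12 m3 l3
    have r2 : ac1 ≠ bd1 := Dx a3 a4 (by simp [*])
    have r3 : ac1 ≠ bd2 := D12 m3 l4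
    have r4 : ac1 ≠ ab1 := Dx a3 a2 (by simp [*, hbc.symm])
    have r5 : ac1 ≠ cd1 := Dx a3 a5 (by simp [*])
    have r6 : ac2 ≠ bd1 := (D12 m4 l3).symm
    have r7 : ac2 ≠ bd2 := Dx b3 b4 (by simp [*])
    have r8 : ac2 ≠ ab1 := (D12 m2 l3).symm
    have r9 : ac2 ≠ cd1 := (D12 m5 l3).symm
    have r10 : bd1 ≠ bd2 := D12 m4 l4
    have r11 : bd1 ≠ ab1 := Dx a4 a2 (by simp [*, hab.symm, hbd.symm, had.symm])
    have r12 : bd1 ≠ cd1 := Dx a4 a5 (by simp [*])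
    have r13 : bd2 ≠ ab1 := (D12 m2 l4).symm
    have r14 : bd2 ≠ cd1 := (D12 m5 l4).symm
    have r15 : ab1 ≠ cd1 := Dx a2 a5 (by simp [*])
    have r16 : cd1 ∉ (∅ : Set G.E) := by simp
    have hfin : (({cd1} : Set G.E)) = insert cd1 ∅ := by simp
    rw [hfin]
    refine Real.ins (k := f1) ?_ hf1 (by simp [r1, r2, r3, r4, r5]) a3
    refine Real.ins (k := f2) ?_ hf2 (by simp [r6, r7, r8, r9]) b3
    refine Real.ins (k := g1) ?_ hg1 (by simp [r10, r11, r12]) a4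
    refine Real.ins (k := g2) ?_ hg2 (by simp [r13, r14]) b4
    refine Real.ins (k := k1) ?_ hk1 (by simp [r15]) a2
    refine Real.ins (k := k2) ?_ hk2 (by simp) a5
    convert real_empty using 1
    funext w
    simp only [dd, Pi.sub_apply, Pi.smul_apply, smul_eq_mul, Pi.single_apply, Pi.zero_apply]
    by_cases wa : w = a
    · subst wa; simp only [hab, hac, had, if_true, if_false]; linear_combination -hf
    by_cases wb : w = b
    · subst wb; simp only [hab.symm, hbc, hbd, if_true, if_false]; linear_combination -hg
    by_cases wc : w = c
    · subst wc; simp only [hac.symm, hbc.symm, hcd, if_true, if_false]; linear_combination hf - hk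
    by_cases wd : w = d
    · subst wd; simp only [had.symm, hbd.symm, hcd.symm, if_true, if_false]
      linear_combination hsum + hg + hk
    · simp only [wa, wb, wc, wd, if_false]
      rw [hβ.1 w (by simp [*])]; ring
  · have s1 : bc1 ≠ ab2 := D12 m1 l2
    have s2 : cd2 ≠ ab2 := Dx b5 b2 (by simp [*, hac.symm, hbc.symm, hbd.symm, had.symm])
    have s3 : ad2 ≠ ab2 := Dx b1 b2 (by simp [*, hbd.symm])
    have s4 : bc1 ≠ cd2 := D12 m1 l5
    have s5 : bc1 ≠ ad2 := D12 m1 l1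
    have s6 : cd2 ≠ ad2 := Dx b5 b1 (by simp [*, hac.symm])
    obtain ⟨D0, hD0⟩ := exists_or (G := G)
    obtain ⟨D1, hD1, u1, v1⟩ := set_or hD0 b2
    obtain ⟨D2, hD2, u2, v2⟩ := set_or hD1 a1
    obtain ⟨D3, hD3, u3, v3⟩ := set_or hD2 b5
    obtain ⟨D4, hD4, u4, v4⟩ := set_or hD3 (b1.trans Sym2.eq_swap)
    have t1 : ∃ e ∈ ({ab2, bc1, cd2, ad2} : Set G.E), D4 e = (a, b) :=
      ⟨ab2, by simp, by rw [v4 _ s3.symm, v3 _ s2.symm, v2 _ s1.symm, u1]⟩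
    have t2 : ∃ e ∈ ({ab2, bc1, cd2, ad2} : Set G.E), D4 e = (b, c) :=
      ⟨bc1, by simp, by rw [v4 _ s5, v3 _ s4, u2]⟩
    have t3 : ∃ e ∈ ({ab2, bc1, cd2, ad2} : Set G.E), D4 e = (c, d) :=
      ⟨cd2, by simp, by rw [v4 _ s6, u3]⟩
    have t4 : ∃ e ∈ ({ab2, bc1, cd2, ad2} : Set G.E), D4 e = (d, a) :=
      ⟨ad2, by simp, u4⟩
    refine so_of_hub hD4 a ?_
    intro u hu
    rcases hu with rfl | rfl | rfl | rfl
    · exact ⟨.refl, .refl⟩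
    · exact ⟨.single t1, .tail (.tail (.single t2) t3) t4⟩
    · exact ⟨.tail (.single t1) t2, .tail (.single t3) t4⟩
    · exact ⟨.tail (.tail (.single t1) t2) t3, .single t4⟩

lemma case_four {S : Set G.V} {F1 I1 F2 I2 : Set G.E} (h1 : TT G S F1 I1) (h2 : TT G S F2 I2)
    (hd : Disjoint F1 F2) (hS : S.ncard = 4) : Good S (F1 ∪ F2) := by
  obtain ⟨c, hc⟩ := h1.toET.exists_col
  obtain ⟨p, s, q, r, ps, pq, pr, sq, sr, qr, hSe, -, a1, a2, a3, a4, a5⟩ := four h1 hS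
  obtain ⟨p', s', q', r', ps', pq', pr', sq', sr', qr', hSe', ⟨m, hm, hme⟩, b1, b2, b3, b4, b5⟩ :=
    four h2 hS
  by_cases hcc : c q' = c r'
  swap
  · exact step_A h1 h2 hd hc hm hme hcc
  have key : ∀ {a b : G.V}, Ad F1 a b → c a ≠ c b := by
    rintro a b ⟨f, hf, hab⟩
    exact hc f hf a b hab
  have k1 := key a1
  have k2 := key a2
  have k3 := key a3
  have k4 := key a4
  have k5 := key a5
  have hE : ∀ w, (w = p ∨ w = s ∨ w = q ∨ w = r) ↔ (w = p' ∨ w = s' ∨ w = q' ∨ w = r') := by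
    intro w
    have : w ∈ S ↔ w ∈ S := Iff.rfl
    conv at this => lhs; rw [hSe]
    conv at this => rhs; rw [hSe']
    simpa using this
  have hq' := (hE q').2 (by simp)
  have hr' := (hE r').2 (by simp)
  have hp' := (hE p').2 (by simp)
  have hs' := (hE s').2 (by simp)
  have e1 : (q' = p ∧ r' = s) ∨ (q' = s ∧ r' = p) := by
    rcases hq' with x1 | x1 | x1 | x1 <;> rcases hr' with x2 | x2 | x2 | x2 <;>
      rw [x1, x2] at hcc
    · exact absurd (x1.trans x2.symm) qr'
    · exact Or.inl ⟨x1, x2⟩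
    · exact absurd hcc k2
    · exact absurd hcc k3
    · exact Or.inr ⟨x1, x2⟩
    · exact absurd (x1.trans x2.symm) qr'
    · exact absurd hcc k4
    · exact absurd hcc k5
    · exact absurd hcc.symm k2
    · exact absurd hcc.symm k4
    · exact absurd (x1.trans x2.symm) qr'
    · exact absurd hcc k1
    · exact absurd hcc.symm k3
    · exact absurd hcc.symm k5
    · exact absurd hcc.symm k1
    · exact absurd (x1.trans x2.symm) qr'
  have b1' : Ad F2 p s := by
    rcases e1 with ⟨rfl, rfl⟩ | ⟨rfl, rfl⟩
    · exact b1
    · exact b1.symm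
  have np : (p' ≠ p ∧ p' ≠ s) ∧ (s' ≠ p ∧ s' ≠ s) := by
    rcases e1 with ⟨h, h'⟩ | ⟨h, h'⟩
    · rw [← h, ← h']; exact ⟨⟨pq', pr'⟩, ⟨sq', sr'⟩⟩
    · rw [← h, ← h']; exact ⟨⟨pr', pq'⟩, ⟨sr', sq'⟩⟩
  have e2 : (p' = q ∧ s' = r) ∨ (p' = r ∧ s' = q) := by
    have x1 := (hp'.resolve_left np.1.1).resolve_left np.1.2
    have x2 := (hs'.resolve_left np.2.1).resolve_left np.2.2
    rcases x1 with x1 | x1 <;> rcases x2 with x2 | x2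
    · exact absurd (x1.trans x2.symm) ps'
    · exact Or.inl ⟨x1, x2⟩
    · exact Or.inr ⟨x1, x2⟩
    · exact absurd (x1.trans x2.symm) ps'
  have hS2 : S = {p, q, r, s} := by
    rw [hSe, Set.insert_comm s q, Set.pair_comm s r]
  rw [hS2]
  have : Ad F2 p q ∧ Ad F2 p r ∧ Ad F2 q s ∧ Ad F2 r s := by
    rcases e1 with ⟨rfl, rfl⟩ | ⟨rfl, rfl⟩ <;> rcases e2 with ⟨rfl, rfl⟩ | ⟨rfl, rfl⟩
    · exact ⟨b2.symm, b4.symm, b3, b5⟩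
    · exact ⟨b4.symm, b2.symm, b5, b3⟩
    · exact ⟨b3.symm, b5.symm, b2, b4⟩
    · exact ⟨b5.symm, b3.symm, b4, b2⟩
  exact special hd pq pr ps qr sq.symm sr.symm a1 a2 a3 a4.symm a5.symm b1' this.1 this.2.1
    this.2.2.1 this.2.2.2

lemma On.mk' {I : Set G.E} {f : G.E} {a b : G.V} (hf : f ∈ I) (h : G.ends f = s(a, b)) :
    On I a ∧ On I b := ⟨⟨f, hf, by simp [h]⟩, ⟨f, hf, by simp [h]⟩⟩

/-- if all edges of `I` touching `u` or `v` equal `e = uv`, then only `u, v` are on `I` -/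
lemma TT.only {S : Set G.V} {F I : Set G.E} (h : TT G S F I) {e : G.E} (he : e ∈ I) {u v : G.V}
    (huv : G.ends e = s(u, v)) (hu : ∀ f ∈ I, u ∈ G.ends f → f = e)
    (hv : ∀ f ∈ I, v ∈ G.ends f → f = e) : ∀ w, On I w → w = u ∨ w = v := by
  intro w hw
  have := h.const (fun w => (w = u ∨ w = v : Prop)) ?_ u w (On.mk' he huv).1 hw
  · simpa using this
  · intro f hf a b hab
    have aux : (a = u ∨ a = v ∨ b = u ∨ b = v) → f = e := by
      rintro (rfl | rfl | rfl | rfl)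
      · exact hu f hf (by simp [hab])
      · exact hv f hf (by simp [hab])
      · exact hu f hf (by simp [hab])
      · exact hv f hf (by simp [hab])
    by_cases hfe : f = e
    · subst hfe
      rw [huv] at hab
      rcases Sym2.eq_iff.1 hab with ⟨rfl, rfl⟩ | ⟨rfl, rfl⟩ <;> simp
    · have : ¬ (a = u ∨ a = v ∨ b = u ∨ b = v) := fun h => hfe (aux h)
      simp only [not_or] at this
      simp [this]

lemma case_big {S : Set G.V} {F1 I1 F2 I2 : Set G.E} (h1 : TT G S F1 I1) (h2 : TT G S F2 I2)
    (hd : Disjoint F1 F2) (hS : 5 ≤ S.ncard)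
    (ih : ∀ x ∈ S, ∀ F1 I1 F2 I2, TT G (S \ {x}) F1 I1 → TT G (S \ {x}) F2 I2 → Disjoint F1 F2 →
      Good (S \ {x}) (F1 ∪ F2)) : Good S (F1 ∪ F2) := by
  by_contra hG
  have hI1 : I1 ≠ ∅ := by
    intro h; have := h1.card.1 h; omega
  have hI2 : I2 ≠ ∅ := by
    intro h; have := h2.card.1 h; omega
  have hcov : ∀ w ∈ S, On I1 w ∨ On I2 w := by
    intro w hw
    by_contra hcon
    rw [not_or] at hcon
    exact hG (step_C h1 h2 hd hI1 hI2 hw hcon.1 hcon.2 (ih w hw))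
  obtain ⟨c, hc⟩ := h1.toET.exists_col
  have hcon : ∀ p q, On I2 p → On I2 q → c p = c q := by
    refine h2.const c ?_
    intro f hf a b hab
    by_contra hne
    exact hG (step_A h1 h2 hd hc hf hab hne)
  obtain ⟨x, hx, hlx, e, he, u, v, huv, e1, he1, e2, he2, h1e, h2e⟩ := h1.last hI1
  have hxI : On I2 x := (hcov x hx).resolve_left hlx
  have hu : ¬ On I2 u := fun h => hc e1 he1 x u h1e (hcon x u hxI h)
  have hv : ¬ On I2 v := fun h => hc e2 he2 x v h2e (hcon x v hxI h)
  have huS : u ∈ S := h1.sub e1 he1 u (by simp [h1e])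
  have hvS : v ∈ S := h1.sub e2 he2 v (by simp [h2e])
  have B2 : ∀ {y}, y ∈ S → ¬ On I2 y → ∀ {f g : G.E}, f ∈ I1 → g ∈ I1 → y ∈ G.ends f → y ∈ G.ends g →
      f = g := by
    intro y hy hl f g hf hg hyf hyg
    by_contra hne
    exact hG (by
      rw [Set.union_comm]
      exact step_B h2 h1 hd.symm hy hl hf hg hne hyf hyg)
  have B1 : ∀ {y}, y ∈ S → ¬ On I1 y → ∀ {f g : G.E}, f ∈ I2 → g ∈ I2 → y ∈ G.ends f → y ∈ G.ends g →
      f = g := by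
    intro y hy hl f g hf hg hyf hyg
    by_contra hne
    exact hG (step_B h1 h2 hd hy hl hf hg hne hyf hyg)
  have O1 := h1.only he huv (fun f hf h => B2 huS hu hf he h (by simp [huv]))
    (fun f hf h => B2 hvS hv hf he h (by simp [huv]))
  obtain ⟨g, hg, y, hy⟩ := hxI
  have hyI : On I2 y := (On.mk' hg hy).2
  have hyS : y ∈ S := h2.sub g (h2.I_sub hg) y (by simp [hy])
  have hly : ¬ On I1 y := by
    intro h
    rcases O1 y h with rfl | rfl
    · exact hu hyI
    · exact hv hyI
  have O2 := h2.only hg hy (fun f hf h => B1 hx hlx hf hg h (by simp [hy]))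
    (fun f hf h => B1 hyS hly hf hg h (by simp [hy]))
  have hsub : S ⊆ ({u, v, x, y} : Finset G.V) := by
    intro w hw
    rcases hcov w hw with h | h
    · rcases O1 w h with rfl | rfl <;> simp
    · rcases O2 w h with rfl | rfl <;> simp
  have := Set.ncard_le_ncard hsub (Finset.finite_toSet _)
  rw [Set.ncard_coe_finset] at this
  have := this.trans Finset.card_le_four
  omega

lemma main : ∀ (n : ℕ) (S : Set G.V), S.ncard = n + 4 → ∀ F1 I1 F2 I2, TT G S F1 I1 → TT G S F2 I2 →
    Disjoint F1 F2 → Good S (F1 ∪ F2) := by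
  intro n
  induction n with
  | zero => intro S hS F1 I1 F2 I2 h1 h2 hd; exact case_four h1 h2 hd hS
  | succ n ih =>
    intro S hS F1 I1 F2 I2 h1 h2 hd
    refine case_big h1 h2 hd (by omega) ?_
    intro x hx
    refine ih _ ?_
    have := Set.ncard_sdiff_singleton_add_one hx (Set.toFinite S)
    omega

lemma deg_dd (D : G.E → G.V × G.V) (v : G.V) :
    ((G.outDeg D v : ZMod 3) - (G.inDeg D v : ZMod 3)) = (∑ e, dd (G := G) (D e).1 (D e).2) v := by
  have aux : ∀ p : G.E → Prop, (({e | p e}.ncard : ℕ) : ZMod 3) = ∑ e, if p e then 1 else 0 := by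
    intro p
    rw [Finset.sum_boole, ← Set.ncard_coe_finset]
    simp
  unfold outDeg inDeg
  rw [aux, aux, Finset.sum_apply, ← Finset.sum_sub_distrib]
  refine Finset.sum_congr rfl fun e _ => ?_
  simp [dd, Pi.single_apply, eq_comm]

lemma bd_sum {S : Set G.V} (T : Finset G.E) (h : G.E → G.V → ZMod 3) (hh : ∀ e, Bd S (h e)) :
    Bd S (∑ e ∈ T, h e) := by
  induction T using Finset.induction_on with
  | empty => simp [Bd]
  | insert a T ha ih => rw [Finset.sum_insert ha]; exact (hh a).add ih

lemma good_inS3 {F : Set G.E} (h : Good (G := G) Set.univ F) : G.InS3 := by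
  obtain ⟨H, K, -, -, hHK, zc, D2, hD2, so⟩ := h
  intro β hβ
  have hB : Bd (G := G) Set.univ (β - ∑ e ∈ Finset.univ.filter (fun e => e ∉ H), dd (D2 e).1 (D2 e).2) := by
    refine Bd.sub ⟨fun v hv => absurd (Set.mem_univ v) hv, hβ⟩ ?_
    exact bd_sum _ _ (fun e => bd_dd (Set.mem_univ _) (Set.mem_univ _))
  obtain ⟨D1, hD1, hs⟩ := zc _ hB
  refine ⟨fun e => if e ∈ H then D1 e else D2 e, ?_, ?_, ?_⟩
  · intro e
    by_cases he : e ∈ H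
    · simpa [he] using hD1 e
    · simpa [he] using hD2 e
  · intro u v
    refine Relation.ReflTransGen.mono ?_ u v (so u (Set.mem_univ _) v (Set.mem_univ _))
    rintro p q ⟨e, he, hpq⟩
    refine ⟨e, ?_⟩
    have : e ∉ H := fun h => Set.disjoint_left.1 hHK h he
    simpa [this] using hpq
  · intro v
    rw [deg_dd]
    refine congrFun ?_ v
    have hs' := eq_sub_iff_add_eq.1 hs
    rw [← hs', Finset.sum_filter, ← Finset.sum_add_distrib]
    refine Finset.sum_congr rfl fun e _ => ?_
    by_cases he : e ∈ H <;> simp [he]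

lemma final {F1 F2 : Set G.E} (hn : 4 ≤ Fintype.card G.V)
    (h1 : G.IsTriangleTree Set.univ F1) (h2 : G.IsTriangleTree Set.univ F2)
    (hdisj : Disjoint F1 F2) : G.InS3 := by
  obtain ⟨I1, t1⟩ := exists_TT h1
  obtain ⟨I2, t2⟩ := exists_TT h2
  refine good_inS3 (main (Fintype.card G.V - 4) Set.univ ?_ _ _ _ _ t1 t2 hdisj)
  rw [Set.ncard_univ, Nat.card_eq_fintype_card]
  omega

end TTP
end Multigraph

/-- Every graph with at least 4 vertices containing two edge-disjoint
spanning triangle-trees belongs to `S3`. -/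
theorem stmt_16 (G : Multigraph) (hn : 4 ≤ Fintype.card G.V)
    (F1 F2 : Set G.E)
    (h1 : G.IsTriangleTree Set.univ F1) (h2 : G.IsTriangleTree Set.univ F2)
    (hdisj : Disjoint F1 F2) :
    G.InS3 := by
  exact Multigraph.TTP.final hn h1 h2 hdisj
end
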